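/- arXiv:2112.15133 — 4 statements merged into one kernel-verified Lean document; each statement's English description precedes it below -/
import Mathlib

section
/- Let n ≥ 2, let V : (0,∞) → ℝ be measurable, essentially bounded, and compactly supported, and let h > 0, E > 0, ε ≥ 0, m ≥ −h²/4, and ν := h⁻¹(m + h²/4)^{1/2}. Then there exists a function u₀ : (0,∞) → ℂ with u₀ and u₀' locally absolutely continuous such that: (i) −h² u₀'' + (V + m r⁻² − E − iε) u₀ = 0 almost everywhere on (0,∞); (ii) u₀ does not vanish on some interval (0,δ) with δ > 0, and if ε = 0 then u₀ can be chosen real-valued with u₀ > 0 on (0,δ); (iii) for every r* > 0 there is a constant C such that |u₀(r)| ≤ C r^{ν + 1/2} for all r ∈ (0, r*]; and (iv) lim_{r→0⁺} ( (n−1)/(2r) · u₀(r) − u₀'(r) ) · r^{(n−1)/2} = 0. -/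
open MeasureTheory Set Filter

/-- `f` is locally absolutely continuous on `(0,∞)` with (a.e.) derivative `f'`. -/
def HasACDerivOn (f f' : ℝ → ℂ) : Prop :=
  ∀ a b : ℝ, 0 < a → a ≤ b →
    IntervalIntegrable f' volume a b ∧ f b - f a = ∫ x in a..b, f' x


/-- The weighted primitive `t ^ (-p) ∫₀ᵗ s ^ p f(s) ds`. -/
noncomputable def weightedPrimitive (p : ℝ) (f : ℝ → ℂ) (t : ℝ) : ℂ :=
  (t ^ p)⁻¹ • ∫ s in (0 : ℝ)..t, s ^ p • f s

section WeightedPrimitive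

variable {p l D : ℝ} {f : ℝ → ℂ}

lemma intervalIntegrable_rpow_smul (hp : 0 ≤ p) (hf : Measurable f)
    (hD : ∀ s, ‖f s‖ ≤ D * Real.exp (l * s)) (a b : ℝ) :
    IntervalIntegrable (fun s => s ^ p • f s) volume a b := by
  have hc : Continuous fun s : ℝ => |s ^ p| * (D * Real.exp (l * s)) :=
    (Real.continuous_rpow_const hp).abs.mul (by fun_prop)
  refine (hc.intervalIntegrable a b).mono_fun' ?_ ?_
  · exact ((Real.continuous_rpow_const hp).measurable.smul hf).aestronglyMeasurable
  · filter_upwards with s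
    rw [norm_smul, Real.norm_eq_abs]
    gcongr
    exact hD s

lemma continuous_integral_rpow_smul (hp : 0 ≤ p) (hf : Measurable f)
    (hD : ∀ s, ‖f s‖ ≤ D * Real.exp (l * s)) :
    Continuous fun t => ∫ s in (0 : ℝ)..t, s ^ p • f s :=
  intervalIntegral.continuous_primitive (intervalIntegrable_rpow_smul hp hf hD) 0

lemma measurable_weightedPrimitive (hp : 0 ≤ p) (hf : Measurable f)
    (hD : ∀ s, ‖f s‖ ≤ D * Real.exp (l * s)) : Measurable (weightedPrimitive p f) :=
  (Real.continuous_rpow_const hp).measurable.inv.smul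
    (continuous_integral_rpow_smul hp hf hD).measurable

lemma norm_weightedPrimitive_le_integral (hp : 0 ≤ p)
    (hD : ∀ s, ‖f s‖ ≤ D * Real.exp (l * s)) {t : ℝ} (ht : 0 ≤ t) :
    ‖weightedPrimitive p f t‖ ≤ ∫ s in (0 : ℝ)..t, D * Real.exp (l * s) := by
  rcases ht.eq_or_lt with rfl | ht
  · simp [weightedPrimitive]
  have hc : Continuous fun s : ℝ => t ^ p * (D * Real.exp (l * s)) := by fun_prop
  have key : ‖∫ s in (0 : ℝ)..t, s ^ p • f s‖ ≤
      ∫ s in (0 : ℝ)..t, t ^ p * (D * Real.exp (l * s)) := by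
    refine intervalIntegral.norm_integral_le_of_norm_le ht.le ?_ (hc.intervalIntegrable _ _)
    filter_upwards with s hs
    rw [norm_smul, Real.norm_eq_abs, abs_of_nonneg (Real.rpow_nonneg hs.1.le p)]
    exact mul_le_mul (Real.rpow_le_rpow hs.1.le hs.2 hp) (hD s) (norm_nonneg _) (by positivity)
  rw [intervalIntegral.integral_const_mul] at key
  rw [weightedPrimitive, norm_smul, norm_inv, Real.norm_eq_abs, abs_of_pos (by positivity),
    inv_mul_le_iff₀ (by positivity)]
  exact key

lemma integral_const_mul_exp_le (hl : 0 < l) (hD : 0 ≤ D) (t : ℝ) :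
    ∫ s in (0 : ℝ)..t, D * Real.exp (l * s) ≤ D / l * Real.exp (l * t) := by
  have hderiv : ∀ s : ℝ, HasDerivAt (fun s => D / l * Real.exp (l * s))
      (D * Real.exp (l * s)) s := by
    intro s
    refine (((hasDerivAt_id' s).const_mul l).exp.const_mul (D / l)).congr_deriv ?_
    field_simp
  rw [intervalIntegral.integral_eq_sub_of_hasDerivAt (fun s _ => hderiv s)
    (Continuous.intervalIntegrable (by fun_prop) _ _)]
  have : 0 ≤ D / l * Real.exp (l * 0) := by positivity
  linarith

lemma nonneg_of_norm_le_mul_exp (hD : ∀ s, ‖f s‖ ≤ D * Real.exp (l * s)) : 0 ≤ D := by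
  simpa using (norm_nonneg _).trans (hD 0)

lemma norm_weightedPrimitive_le_exp (hp : 0 ≤ p) (hl : 0 < l)
    (hD : ∀ s, ‖f s‖ ≤ D * Real.exp (l * s)) {t : ℝ} (ht : 0 ≤ t) :
    ‖weightedPrimitive p f t‖ ≤ D / l * Real.exp (l * t) :=
  (norm_weightedPrimitive_le_integral hp hD ht).trans
    (integral_const_mul_exp_le hl (nonneg_of_norm_le_mul_exp hD) t)

lemma norm_weightedPrimitive_le_mul (hp : 0 ≤ p) (hl : 0 < l)
    (hD : ∀ s, ‖f s‖ ≤ D * Real.exp (l * s)) {t R : ℝ} (ht : 0 ≤ t) (htR : t ≤ R) :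
    ‖weightedPrimitive p f t‖ ≤ D * Real.exp (l * R) * t := by
  have hD0 := nonneg_of_norm_le_mul_exp hD
  refine (norm_weightedPrimitive_le_integral hp hD ht).trans ?_
  have : ∫ s in (0 : ℝ)..t, D * Real.exp (l * s) ≤ ∫ _s in (0 : ℝ)..t, D * Real.exp (l * R) := by
    refine intervalIntegral.integral_mono_on ht (Continuous.intervalIntegrable (by fun_prop) _ _)
      (by simp) fun s hs => ?_
    gcongr
    exact hs.2.trans htR
  rwa [intervalIntegral.integral_const, smul_eq_mul, sub_zero, mul_comm t] at this

lemma intervalIntegrable_weightedPrimitive (hp : 0 ≤ p) (hl : 0 < l) (hf : Measurable f)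
    (hD : ∀ s, ‖f s‖ ≤ D * Real.exp (l * s)) {a b : ℝ} (ha : 0 ≤ a) (hb : 0 ≤ b) :
    IntervalIntegrable (weightedPrimitive p f) volume a b := by
  have hc : Continuous fun s : ℝ => D / l * Real.exp (l * s) := by fun_prop
  refine (hc.intervalIntegrable a b).mono_fun'
    (measurable_weightedPrimitive hp hf hD).aestronglyMeasurable ?_
  filter_upwards [ae_restrict_mem measurableSet_uIoc] with s hs
  exact norm_weightedPrimitive_le_exp hp hl hD ((le_min ha hb).trans hs.1.le)

lemma norm_integral_weightedPrimitive_le (hp : 0 ≤ p) (hl : 0 < l)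
    (hD : ∀ s, ‖f s‖ ≤ D * Real.exp (l * s)) {t : ℝ} (ht : 0 ≤ t) :
    ‖∫ s in (0 : ℝ)..t, weightedPrimitive p f s‖ ≤ D / l / l * Real.exp (l * t) := by
  have hD0 := nonneg_of_norm_le_mul_exp hD
  have hc : Continuous fun s : ℝ => D / l * Real.exp (l * s) := by fun_prop
  refine (intervalIntegral.norm_integral_le_of_norm_le ht ?_ (hc.intervalIntegrable _ _)).trans
    (integral_const_mul_exp_le hl (by positivity) t)
  filter_upwards with s hs
  exact norm_weightedPrimitive_le_exp hp hl hD hs.1.le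

lemma weightedPrimitive_sub (hp : 0 ≤ p) {g : ℝ → ℂ} {D' : ℝ} (hf : Measurable f)
    (hD : ∀ s, ‖f s‖ ≤ D * Real.exp (l * s)) (hg : Measurable g)
    (hD' : ∀ s, ‖g s‖ ≤ D' * Real.exp (l * s)) (t : ℝ) :
    weightedPrimitive p (fun s => f s - g s) t =
      weightedPrimitive p f t - weightedPrimitive p g t := by
  simp only [weightedPrimitive, smul_sub]
  rw [intervalIntegral.integral_sub (intervalIntegrable_rpow_smul hp hf hD 0 t)
    (intervalIntegrable_rpow_smul hp hg hD' 0 t), smul_sub]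

lemma conj_weightedPrimitive (t : ℝ) :
    weightedPrimitive p (fun s => starRingEnd ℂ (f s)) t =
      starRingEnd ℂ (weightedPrimitive p f t) := by
  simp only [weightedPrimitive, Complex.real_smul, map_mul, Complex.conj_ofReal,
    ← intervalIntegral.intervalIntegral_conj]

end WeightedPrimitive

open scoped BoundedContinuousFunction in
/-- The Volterra equation `φ(r) = 1 + ∫₀ʳ t ^ (-p) ∫₀ᵗ s ^ p q(s) φ(s) ds dt` has a continuous
exponentially bounded solution, which is real when `q` is. -/
lemma exists_volterra_solution {p K : ℝ} {q : ℝ → ℂ} (hp : 0 ≤ p) (hq : Measurable q)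
    (hK : ∀ s, ‖q s‖ ≤ K) :
    ∃ φ : ℝ → ℂ, ∃ l > 0, ∃ D : ℝ, Continuous φ ∧ (∀ s, ‖q s * φ s‖ ≤ D * Real.exp (l * s)) ∧
      (∀ r, 0 ≤ r → φ r = 1 + ∫ t in (0 : ℝ)..r, weightedPrimitive p (fun s => q s * φ s) t) ∧
      ((∀ s, (q s).im = 0) → ∀ s, (φ s).im = 0) := by
  have hK0 : 0 ≤ K := (norm_nonneg _).trans (hK 0)
  set l : ℝ := 2 * K + 1 with hl
  have hl0 : 0 < l := by positivity
  have hKl : K / l / l ≤ 1 / 2 := by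
    rw [div_div, div_le_iff₀ (by positivity)]
    nlinarith
  let F (g : ℝ →ᵇ ℂ) (s : ℝ) : ℂ := q s * (Real.exp (l * s) • g s)
  have hFm (g : ℝ →ᵇ ℂ) : Measurable (F g) :=
    hq.mul (Continuous.measurable (by fun_prop))
  have hFb (g : ℝ →ᵇ ℂ) (s : ℝ) : ‖F g s‖ ≤ K * ‖g‖ * Real.exp (l * s) := by
    rw [norm_mul, norm_smul, Real.norm_eq_abs, Real.abs_exp, mul_assoc, mul_comm ‖g‖]
    gcongr
    exacts [hK s, g.norm_coe_le_norm s]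
  let I (g : ℝ →ᵇ ℂ) (r : ℝ) : ℂ := ∫ t in (0 : ℝ)..max r 0, weightedPrimitive p (F g) t
  have hIc (g : ℝ →ᵇ ℂ) : Continuous (I g) := by
    have h1 : Continuous fun r : ℝ => ∫ t in (0 : ℝ)..r, weightedPrimitive p (F g) (max t 0) := by
      refine intervalIntegral.continuous_primitive (fun a b => ?_) 0
      have hc : Continuous fun s : ℝ => K * ‖g‖ / l * Real.exp (l * max s 0) := by fun_prop
      refine (hc.intervalIntegrable a b).mono_fun'
        ((measurable_weightedPrimitive hp (hFm g) (hFb g)).comp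
          (measurable_id.max measurable_const)).aestronglyMeasurable ?_
      filter_upwards with s
      exact norm_weightedPrimitive_le_exp hp hl0 (hFb g) (le_max_right _ _)
    convert h1.comp (continuous_id.max continuous_const : Continuous fun r : ℝ => max r 0) using 1
    ext r
    refine intervalIntegral.integral_congr fun t ht => ?_
    rw [uIcc_of_le (le_max_right _ _)] at ht
    simp only [max_eq_left ht.1]
  have hIb (g : ℝ →ᵇ ℂ) (r : ℝ) : ‖I g r‖ ≤ K * ‖g‖ / l / l * Real.exp (l * max r 0) :=
    norm_integral_weightedPrimitive_le hp hl0 (hFb g) (le_max_right _ _)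
  have hex (g : ℝ →ᵇ ℂ) : ∃ G : ℝ →ᵇ ℂ, ∀ r, G r = Real.exp (-(l * max r 0)) • (1 + I g r) := by
    refine ⟨BoundedContinuousFunction.ofNormedAddCommGroup
      (fun r => Real.exp (-(l * max r 0)) • (1 + I g r)) (by fun_prop) (1 + K * ‖g‖ / l / l) ?_,
      fun r => rfl⟩
    intro r
    have hm : 0 ≤ l * max r 0 := mul_nonneg hl0.le (le_max_right _ _)
    rw [norm_smul, Real.norm_eq_abs, Real.abs_exp, Real.exp_neg, inv_mul_le_iff₀ (Real.exp_pos _)]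
    have h1 : ‖(1 : ℂ) + I g r‖ ≤ 1 + ‖I g r‖ := by simpa using norm_add_le (1 : ℂ) (I g r)
    have h2 := hIb g r
    have h3 := Real.one_le_exp hm
    linarith
  choose T hT using hex
  have hcontr : ContractingWith (1 / 2) T := by
    refine ⟨by norm_num, LipschitzWith.of_dist_le_mul fun g g' => ?_⟩
    rw [BoundedContinuousFunction.dist_le (by positivity)]
    intro r
    have hsub : I g r - I g' r = I (g - g') r := by
      simp only [I]
      rw [← intervalIntegral.integral_sub
        (intervalIntegrable_weightedPrimitive hp hl0 (hFm g) (hFb g) le_rfl (le_max_right _ _))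
        (intervalIntegrable_weightedPrimitive hp hl0 (hFm g') (hFb g') le_rfl (le_max_right _ _))]
      refine intervalIntegral.integral_congr fun t _ => ?_
      rw [← weightedPrimitive_sub hp (hFm g) (hFb g) (hFm g') (hFb g')]
      congr 1
      ext s
      simp only [F, BoundedContinuousFunction.coe_sub, Pi.sub_apply, smul_sub, mul_sub]
    rw [dist_eq_norm, hT, hT, ← smul_sub, add_sub_add_left_eq_sub, hsub, norm_smul,
      Real.norm_eq_abs, Real.abs_exp, Real.exp_neg, inv_mul_le_iff₀ (Real.exp_pos _), dist_eq_norm]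
    refine (hIb (g - g') r).trans ?_
    have : K * ‖g - g'‖ / l / l = K / l / l * ‖g - g'‖ := by ring
    rw [this, mul_comm]
    push_cast
    gcongr
  obtain ⟨g, hg⟩ : ∃ g, g = ContractingWith.fixedPoint T hcontr := ⟨_, rfl⟩
  have hfix : T g = g := by rw [hg]; exact hcontr.fixedPoint_isFixedPt
  refine ⟨fun s => Real.exp (l * s) • g s, l, hl0, K * ‖g‖, by fun_prop, hFb g, ?_, ?_⟩
  · intro r hr
    have h1 := hT g r
    rw [hfix, max_eq_left hr] at h1
    simp only [h1, smul_smul, ← Real.exp_add, add_neg_cancel, Real.exp_zero, one_smul, I,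
      max_eq_left hr, F]
  · intro hreal s
    have hstar : T (star g) = star g := by
      conv_rhs => rw [← hfix]
      ext r
      have hI : I (star g) r = starRingEnd ℂ (I g r) := by
        simp only [I]
        rw [← intervalIntegral.intervalIntegral_conj]
        refine intervalIntegral.integral_congr fun t _ => ?_
        rw [← conj_weightedPrimitive]
        congr 1
        ext x
        simp [F, Complex.conj_eq_iff_im.2 (hreal x), Complex.conj_ofReal, -Complex.ofReal_exp]
      rw [BoundedContinuousFunction.star_apply, hT, hT, hI]
      simp [Complex.conj_ofReal, -Complex.ofReal_exp]
    have hgs : star g = g := by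
      rw [hcontr.fixedPoint_unique (x := star g) hstar, ← hg]
    have := congrArg (fun G : ℝ →ᵇ ℂ => G s) hgs
    simp only [BoundedContinuousFunction.star_apply] at this
    have him : (g s).im = 0 := Complex.conj_eq_iff_im.1 this
    simp [him, -Complex.ofReal_exp]

section AbsolutelyContinuous

variable {E : Type*} [NormedAddCommGroup E] [NormedSpace ℝ E] {a b B : ℝ}

lemma absolutelyContinuousOnInterval_integral_of_norm_le {f : ℝ → E} {c : ℝ}
    (hf : ∀ x ∈ uIcc a b, IntervalIntegrable f volume c x) (hB : ∀ x ∈ uIcc a b, ‖f x‖ ≤ B) :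
    AbsolutelyContinuousOnInterval (fun x => ∫ t in c..x, f t) a b := by
  have hB0 : 0 ≤ B := (norm_nonneg _).trans (hB a left_mem_uIcc)
  refine LipschitzOnWith.absolutelyContinuousOnInterval (K := B.toNNReal) ?_
  refine LipschitzOnWith.of_dist_le_mul fun x hx y hy => ?_
  rw [dist_eq_norm, intervalIntegral.integral_interval_sub_left (hf x hx) (hf y hy),
    Real.coe_toNNReal _ hB0, Real.dist_eq]
  exact intervalIntegral.norm_integral_le_of_norm_le_const fun t ht =>
    hB t (uIcc_subset_uIcc hy hx (uIoc_subset_uIcc ht))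

/-- Fundamental theorem of calculus for vector-valued absolutely continuous functions with bounded
derivative. -/
lemma AbsolutelyContinuousOnInterval.integral_eq_sub_of_ae_hasDerivAt [CompleteSpace E]
    {u u' : ℝ → E}
    (hu : AbsolutelyContinuousOnInterval u a b) (hint : IntervalIntegrable u' volume a b)
    (hB : ∀ x ∈ uIcc a b, ‖u' x‖ ≤ B)
    (hd : ∀ᵐ x, x ∈ uIcc a b → HasDerivAt u (u' x) x) :
    u b - u a = ∫ x in a..b, u' x := by
  have hI : AbsolutelyContinuousOnInterval (fun x => ∫ t in a..x, u' t) a b :=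
    absolutelyContinuousOnInterval_integral_of_norm_le
      (fun x hx => hint.mono_set (uIcc_subset_uIcc left_mem_uIcc hx)) hB
  obtain ⟨C, hC⟩ := (hu.sub hI).const_of_ae_hasDerivAt_zero (by
    filter_upwards [hd, hint.ae_hasDerivAt_integral] with x hx₁ hx₂ hx
    simpa using! (hx₁ hx).sub (hx₂ hx a left_mem_uIcc))
  have ha := hC a left_mem_uIcc
  have hb := hC b right_mem_uIcc
  simp only [Pi.sub_apply, intervalIntegral.integral_same, sub_zero] at ha hb
  rw [ha, ← hb, sub_sub_cancel]

end AbsolutelyContinuous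

lemma absolutelyContinuousOnInterval_const_mul_rpow (c e : ℝ) {x y : ℝ} (hx : 0 < x)
    (hxy : x ≤ y) : AbsolutelyContinuousOnInterval (fun r : ℝ => c * r ^ e) x y := by
  refine ContDiffOn.absolutelyContinuousOnInterval fun r hr => ?_
  rw [uIcc_of_le hxy] at hr
  exact (contDiffAt_const.mul
    (Real.contDiffAt_rpow_const_of_ne (hx.trans_le hr.1).ne')).contDiffWithinAt

/-- A solution `φ` of the Volterra equation with weight `r ^ (2 a)` yields the solution
`r ^ a φ(r)` of `u'' = (a (a - 1) r⁻² + q) u`. -/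
lemma hasACDerivOn_of_volterra {a l D K : ℝ} {q φ : ℝ → ℂ} (ha : 0 ≤ a) (hl : 0 < l)
    (hq : Measurable q) (hK : ∀ s, ‖q s‖ ≤ K) (hφ : Continuous φ)
    (hD : ∀ s, ‖q s * φ s‖ ≤ D * Real.exp (l * s))
    (hv : ∀ r, 0 ≤ r →
      φ r = 1 + ∫ t in (0 : ℝ)..r, weightedPrimitive (2 * a) (fun s => q s * φ s) t) :
    HasACDerivOn (fun r => r ^ a • φ r) (fun r => (a * r ^ (a - 1)) • φ r +
        (1 * r ^ (-a)) • ∫ s in (0 : ℝ)..r, s ^ (2 * a) • (q s * φ s)) ∧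
      HasACDerivOn (fun r => (a * r ^ (a - 1)) • φ r +
        (1 * r ^ (-a)) • ∫ s in (0 : ℝ)..r, s ^ (2 * a) • (q s * φ s))
        (fun r => (((a * (a - 1) * (r ^ 2)⁻¹ : ℝ) : ℂ) + q r) * (r ^ a • φ r)) := by
  have hp : 0 ≤ 2 * a := by positivity
  have hfm : Measurable fun s => q s * φ s := hq.mul hφ.measurable
  set A : ℝ → ℂ := fun r => ∫ s in (0 : ℝ)..r, s ^ (2 * a) • (q s * φ s)
  set W := weightedPrimitive (2 * a) fun s => q s * φ s
  have hAc : Continuous A := continuous_integral_rpow_smul hp hfm hD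
  have hWA (r : ℝ) : W r = (r ^ (2 * a))⁻¹ • A r := rfl
  have hφ' : ∀ r, 0 < r → HasDerivAt φ (W r) r := by
    intro r hr
    have hWc : ContinuousAt W r :=
      ((Real.continuousAt_rpow_const r _ (Or.inl hr.ne')).inv₀ (by positivity)).smul
        hAc.continuousAt
    have h1 := (intervalIntegral.integral_hasDerivAt_right
      (intervalIntegrable_weightedPrimitive hp hl hfm hD le_rfl hr.le)
      (measurable_weightedPrimitive hp hfm hD).stronglyMeasurable.stronglyMeasurableAtFilter
      hWc).const_add 1
    refine h1.congr_of_eventuallyEq ?_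
    filter_upwards [Ioi_mem_nhds hr] with s hs
    exact hv s (le_of_lt hs)
  have hrpow (r : ℝ) (hr : 0 < r) (e : ℝ) :
      HasDerivAt (fun r : ℝ => r ^ e) (e * r ^ (e - 1)) r :=
    Real.hasDerivAt_rpow_const (Or.inl hr.ne')
  have hu : ∀ r, 0 < r →
      HasDerivAt (fun r => r ^ a • φ r) ((a * r ^ (a - 1)) • φ r + (1 * r ^ (-a)) • A r) r := by
    intro r hr
    refine ((hrpow r hr a).smul (hφ' r hr)).congr_deriv ?_
    rw [hWA, smul_smul, one_mul, add_comm]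
    congr 2
    rw [← Real.rpow_neg hr.le, ← Real.rpow_add hr]
    congr 1
    ring
  have hu' : ∀ r, 0 < r → HasDerivAt A (r ^ (2 * a) • (q r * φ r)) r →
      HasDerivAt (fun r => (a * r ^ (a - 1)) • φ r + (1 * r ^ (-a)) • A r)
        ((((a * (a - 1) * (r ^ 2)⁻¹ : ℝ) : ℂ) + q r) * (r ^ a • φ r)) r := by
    intro r hr hAr
    refine ((((hrpow r hr (a - 1)).const_mul a).smul (hφ' r hr)).add
      (((hrpow r hr (-a)).const_mul 1).smul hAr)).congr_deriv ?_
    have e1 : r ^ (a - 1 - 1) = (r ^ 2)⁻¹ * r ^ a := by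
      rw [← Real.rpow_natCast r 2, ← Real.rpow_neg hr.le, ← Real.rpow_add hr]
      congr 1
      push_cast
      ring
    have e2 : r ^ (-a - 1) = r ^ (a - 1) * (r ^ (2 * a))⁻¹ := by
      rw [← Real.rpow_neg hr.le, ← Real.rpow_add hr]
      congr 1
      ring
    have e3 : r ^ (-a) * r ^ (2 * a) = r ^ a := by
      rw [← Real.rpow_add hr]
      congr 1
      ring
    rw [hWA, e1, e2, one_mul, smul_smul (r ^ (-a)), e3]
    simp only [Complex.real_smul]
    push_cast
    ring
  have hpos {x y r : ℝ} (hx : 0 < x) (hxy : x ≤ y) (hr : r ∈ uIcc x y) : 0 < r :=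
    hx.trans_le (by rw [uIcc_of_le hxy] at hr; exact hr.1)
  have hφAC {x y : ℝ} (hx : 0 < x) (hxy : x ≤ y) : AbsolutelyContinuousOnInterval φ x y := by
    refine LipschitzOnWith.absolutelyContinuousOnInterval
      (K := (D / l * Real.exp (l * y)).toNNReal) ?_
    refine (convex_uIcc x y).lipschitzOnWith_of_nnnorm_hasDerivWithin_le
      (fun r hr => (hφ' r (hpos hx hxy hr)).hasDerivWithinAt) fun r hr => ?_
    rw [← NNReal.coe_le_coe, coe_nnnorm]
    refine le_trans ?_ (Real.le_coe_toNNReal _)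
    refine (norm_weightedPrimitive_le_exp hp hl hD (hpos hx hxy hr).le).trans ?_
    have := nonneg_of_norm_le_mul_exp hD
    rw [uIcc_of_le hxy] at hr
    gcongr
    exact hr.2
  have hAAC {x y : ℝ} (hx : 0 < x) (hxy : x ≤ y) : AbsolutelyContinuousOnInterval A x y := by
    refine absolutelyContinuousOnInterval_integral_of_norm_le
      (B := y ^ (2 * a) * (D * Real.exp (l * y)))
      (fun r _ => intervalIntegrable_rpow_smul hp hfm hD 0 r) fun r hr => ?_
    have hr0 := hpos hx hxy hr
    have := nonneg_of_norm_le_mul_exp hD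
    rw [uIcc_of_le hxy] at hr
    rw [norm_smul, Real.norm_eq_abs, abs_of_pos (by positivity)]
    refine mul_le_mul (Real.rpow_le_rpow hr0.le hr.2 hp) ((hD r).trans ?_) (norm_nonneg _)
      (by have := hx.trans_le hxy; positivity)
    gcongr
    exact hr.2
  have hu'AC {x y : ℝ} (hx : 0 < x) (hxy : x ≤ y) : AbsolutelyContinuousOnInterval
      (fun r => (a * r ^ (a - 1)) • φ r + (1 * r ^ (-a)) • A r) x y :=
    ((absolutelyContinuousOnInterval_const_mul_rpow a (a - 1) hx hxy).fun_smul (hφAC hx hxy)).add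
      ((absolutelyContinuousOnInterval_const_mul_rpow 1 (-a) hx hxy).fun_smul (hAAC hx hxy))
  refine ⟨fun x y hx hxy => ?_, fun x y hx hxy => ?_⟩
  · have hint := (hu'AC hx hxy).continuousOn.intervalIntegrable (μ := volume)
    exact ⟨hint, (intervalIntegral.integral_eq_sub_of_hasDerivAt
      (fun r hr => hu r (hpos hx hxy hr)) hint).symm⟩
  · have huc : ContinuousOn (fun r => r ^ a • φ r) (uIcc x y) := fun r hr =>
      (hu r (hpos hx hxy hr)).continuousAt.continuousWithinAt
    have hcc : ContinuousOn (fun r : ℝ => ((a * (a - 1) * (r ^ 2)⁻¹ : ℝ) : ℂ)) (uIcc x y) := by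
      refine Complex.continuous_ofReal.comp_continuousOn (continuousOn_const.mul
        ((continuousOn_pow 2).inv₀ fun r hr => ?_))
      exact (pow_pos (hpos hx hxy hr) 2).ne'
    have hqi : IntervalIntegrable q volume x y :=
      (intervalIntegrable_const (μ := volume) (c := K)).mono_fun' hq.aestronglyMeasurable
        (Eventually.of_forall hK)
    have hint := ((hcc.intervalIntegrable (μ := volume)).add hqi).mul_continuousOn huc
    obtain ⟨B₁, hB₁⟩ := isCompact_uIcc.exists_bound_of_continuousOn hcc
    obtain ⟨B₂, hB₂⟩ := isCompact_uIcc.exists_bound_of_continuousOn huc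
    refine ⟨hint, (hu'AC hx hxy).integral_eq_sub_of_ae_hasDerivAt hint (B := (B₁ + K) * B₂)
      (fun r hr => ?_) ?_⟩
    · rw [norm_mul]
      have h1 := hB₁ r hr
      have h2 := hK r
      have h3 := norm_nonneg (q r)
      exact mul_le_mul ((norm_add_le _ _).trans (add_le_add h1 h2)) (hB₂ r hr) (norm_nonneg _)
        (add_nonneg ((norm_nonneg _).trans h1) (h3.trans h2))
    · filter_upwards [(intervalIntegrable_rpow_smul hp hfm hD 0 y).ae_hasDerivAt_integral]
        with r hr hrxy
      refine hu' r (hpos hx hxy hrxy) (hr ?_ 0 left_mem_uIcc)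
      rw [uIcc_of_le hxy] at hrxy
      rw [uIcc_of_le (hx.le.trans hxy)]
      exact ⟨hx.le.trans hrxy.1, hrxy.2⟩

/-- Existence of the recessive solution `u₀` of
`-h²u₀'' + (V + m r⁻² - E - iε)u₀ = 0` on `(0,∞)`, positive (and real when
`ε = 0`) near `0`, with the growth bound `|u₀(r)| ≤ C r^{ν+1/2}` near `0` and
the boundary asymptotics `((n-1)/(2r) u₀ - u₀') r^{(n-1)/2} → 0` as `r → 0⁺`. -/
theorem exists_recessive_solution
    (n : ℕ) (hn : 2 ≤ n)
    (V : ℝ → ℝ) (hVmeas : Measurable V)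
    (hVbdd : ∃ Cv : ℝ, ∀ᵐ r ∂(volume.restrict (Ioi (0 : ℝ))), |V r| ≤ Cv)
    (hVsupp : HasCompactSupport V)
    (h E ε m : ℝ) (hh : 0 < h) (hE : 0 < E) (hε : 0 ≤ ε) (hm : -h ^ 2 / 4 ≤ m)
    (ν : ℝ) (hν : ν = Real.sqrt (m + h ^ 2 / 4) / h) :
    ∃ u₀ u₀' u₀'' : ℝ → ℂ,
      HasACDerivOn u₀ u₀' ∧ HasACDerivOn u₀' u₀'' ∧
      (∀ᵐ r ∂(volume.restrict (Ioi (0 : ℝ))),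
        -(h : ℂ) ^ 2 * u₀'' r
          + (((V r + m * (r ^ 2)⁻¹ - E : ℝ) : ℂ) - ε * Complex.I) * u₀ r = 0) ∧
      (∃ δ > (0 : ℝ), (∀ r ∈ Ioo (0 : ℝ) δ, u₀ r ≠ 0) ∧
        (ε = 0 → (∀ r ∈ Ioi (0 : ℝ), (u₀ r).im = 0) ∧
          ∀ r ∈ Ioo (0 : ℝ) δ, 0 < (u₀ r).re)) ∧
      (∀ rstar > (0 : ℝ), ∃ C : ℝ, ∀ r ∈ Ioc (0 : ℝ) rstar,
        ‖u₀ r‖ ≤ C * r ^ (ν + 1 / 2)) ∧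
      Tendsto (fun r : ℝ =>
          ((((n : ℝ) - 1) / (2 * r) : ℝ) * u₀ r - u₀' r) * ((r ^ (((n : ℝ) - 1) / 2) : ℝ) : ℂ))
        (nhdsWithin 0 (Ioi 0)) (nhds 0) := by
  obtain ⟨Cv, hCv⟩ := hVbdd
  set a : ℝ := ν + 1 / 2 with ha
  have hν0 : 0 ≤ ν := by rw [hν]; positivity
  have ha0 : 0 < a := by positivity
  have hma : m = h ^ 2 * (a * (a - 1)) := by
    have h1 : (ν * h) ^ 2 = m + h ^ 2 / 4 := by
      rw [hν, div_mul_cancel₀ _ hh.ne', Real.sq_sqrt (by linarith)]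
    rw [ha]
    linarith
  set Vt : ℝ → ℝ := fun r => max (-|Cv|) (min (V r) |Cv|) with hVt
  have hVtb (r : ℝ) : |Vt r| ≤ |Cv| := by
    rw [abs_le]
    exact ⟨le_max_left _ _, max_le (by linarith [abs_nonneg Cv]) (min_le_right _ _)⟩
  set q : ℝ → ℂ := fun r => (((Vt r - E : ℝ) : ℂ) - ε * Complex.I) / (h : ℂ) ^ 2 with hq
  have hqm : Measurable q := by
    have hVtm : Measurable Vt := measurable_const.max (hVmeas.min measurable_const)
    exact ((Complex.measurable_ofReal.comp (hVtm.sub_const E)).sub_const _).div_const _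
  have hqK (s : ℝ) : ‖q s‖ ≤ (|Cv| + E + ε) / h ^ 2 := by
    rw [hq, norm_div, norm_pow, Complex.norm_real, Real.norm_eq_abs, abs_of_pos hh]
    gcongr
    refine (norm_sub_le _ _).trans ?_
    rw [norm_mul, Complex.norm_I, Complex.norm_real, Complex.norm_real, Real.norm_eq_abs,
      Real.norm_eq_abs, abs_of_nonneg hε, mul_one]
    gcongr
    have h1 := abs_le.1 (hVtb s)
    exact abs_le.2 ⟨by linarith, by linarith⟩
  have hp : 0 ≤ 2 * a := by positivity
  obtain ⟨φ, l, hl, D, hφ, hD, hv, hreal⟩ := exists_volterra_solution hp hqm hqK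
  obtain ⟨hAC, hAC'⟩ := hasACDerivOn_of_volterra ha0.le hl hqm hqK hφ hD hv
  refine ⟨_, _, _, hAC, hAC', ?_, ?_, ?_, ?_⟩
  · filter_upwards [hCv] with r hr
    have hVr : Vt r = V r := by
      have h1 := abs_le.1 (hr.trans (le_abs_self Cv))
      rw [hVt]
      simp only [min_eq_left h1.2, max_eq_right h1.1]
    have hhc : (h : ℂ) ≠ 0 := by exact_mod_cast hh.ne'
    simp only [hq, hVr, hma]
    push_cast
    field_simp
    ring
  · have hφ0 : φ 0 = 1 := by simpa using hv 0 le_rfl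
    have hev : ∀ᶠ r in nhds (0 : ℝ), 0 < (φ r).re :=
      (Complex.continuous_re.comp hφ).continuousAt.eventually_const_lt (by simp [hφ0])
    obtain ⟨δ, hδ, hball⟩ := Metric.eventually_nhds_iff.1 hev
    have hre : ∀ r ∈ Ioo (0 : ℝ) δ, 0 < (r ^ a • φ r).re := by
      intro r hr
      rw [Complex.smul_re]
      refine mul_pos (Real.rpow_pos_of_pos hr.1 a) (hball ?_)
      rw [Real.dist_eq, sub_zero, abs_of_pos hr.1]
      exact hr.2
    refine ⟨δ, hδ, fun r hr h0 => ?_, fun hε0 => ⟨fun r _ => ?_, hre⟩⟩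
    · have := hre r hr
      rw [h0] at this
      exact lt_irrefl _ this
    · have hqim (s : ℝ) : (q s).im = 0 := by
        have : q s = (((Vt s - E) / h ^ 2 : ℝ) : ℂ) := by
          simp only [hq, hε0]
          push_cast
          ring
        rw [this, Complex.ofReal_im]
      rw [Complex.smul_im, hreal hqim r, smul_zero]
  · intro R _
    obtain ⟨C, hC⟩ := (isCompact_Icc (a := (0 : ℝ)) (b := R)).exists_bound_of_continuousOn
      hφ.continuousOn
    refine ⟨C, fun r hr => ?_⟩
    have hr0 := Real.rpow_nonneg hr.1.le a
    rw [norm_smul, Real.norm_eq_abs, abs_of_nonneg hr0, mul_comm]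
    exact mul_le_mul_of_nonneg_right (hC r ⟨hr.1.le, hr.2⟩) hr0
  · set W := weightedPrimitive (2 * a) fun s => q s * φ s
    set b : ℝ := ((n : ℝ) - 1) / 2 with hb
    have hb0 : 1 / 2 ≤ b := by
      have : (2 : ℝ) ≤ n := by exact_mod_cast hn
      rw [hb]
      linarith
    have hrpow {e : ℝ} (he : 0 < e) :
        Tendsto (fun r : ℝ => r ^ e) (nhdsWithin 0 (Ioi 0)) (nhds 0) := by
      have h1 := (Real.continuousAt_rpow_const 0 e (Or.inr he.le)).tendsto
      rw [Real.zero_rpow he.ne'] at h1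
      exact h1.mono_left nhdsWithin_le_nhds
    have hlead : Tendsto (fun r : ℝ => (b - a) * r ^ (a - 1 + b)) (nhdsWithin 0 (Ioi 0))
        (nhds 0) := by
      rcases (show 0 ≤ a - 1 + b by linarith).eq_or_lt with he | he
      · have : b - a = 0 := by linarith
        simp [this]
      · simpa using (hrpow he).const_mul (b - a)
    have hW0 : Tendsto W (nhdsWithin 0 (Ioi 0)) (nhds 0) := by
      refine squeeze_zero_norm' (a := fun r => D * Real.exp (l * 1) * r) ?_ ?_
      · filter_upwards [Ioo_mem_nhdsGT (zero_lt_one' ℝ)] with r hr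
        exact norm_weightedPrimitive_le_mul hp hl hD hr.1.le hr.2.le
      · refine (Continuous.tendsto' ?_ 0 0 (by simp)).mono_left nhdsWithin_le_nhds
        fun_prop
    have hlim := (hlead.smul ((hφ.tendsto 0).mono_left nhdsWithin_le_nhds)).sub
      (((hrpow ha0).mul (hrpow (by linarith : 0 < b))).smul hW0)
    simp only [zero_smul, mul_zero, sub_zero] at hlim
    refine hlim.congr' ?_
    filter_upwards [self_mem_nhdsWithin] with r hr
    have hr : 0 < r := hr
    have e1 : ((n : ℝ) - 1) / (2 * r) * r ^ a = b * r ^ (a - 1) := by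
      rw [Real.rpow_sub_one hr.ne', hb]
      field_simp
    have e2 : r ^ (-a) = r ^ a * (r ^ (2 * a))⁻¹ := by
      rw [← Real.rpow_neg hr.le, ← Real.rpow_add hr]
      congr 1
      ring
    have e3 : W r = (r ^ (2 * a))⁻¹ • ∫ s in (0 : ℝ)..r, s ^ (2 * a) • (q s * φ s) := rfl
    have e1' := congrArg (fun x : ℝ => (x : ℂ)) e1
    rw [e2, e3, Real.rpow_add hr]
    simp only [Complex.real_smul, Complex.ofReal_mul] at e1' ⊢
    simp only [Complex.ofReal_sub, Complex.ofReal_one]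
    linear_combination (-((r ^ b : ℝ) : ℂ) * φ r) * e1'
end

section
/- Fix 0 < E_min ≤ E_max, let V : (0,∞) → ℝ be measurable, essentially bounded, and compactly supported with R₀ > 0, and fix R > sup_{E ∈ [E_min, E_max]} R₁(V,E). Then there exist C, h₀ > 0 such that for all h ∈ (0, h₀], all E ∈ [E_min, E_max], all m ∈ [−h²/4, M₊(E)], and all solutions u₀, u₁ as specified (u₀ recessive at 0, u₁ outgoing at infinity), the Wronskian W := u₀ u₁' − u₀' u₁ is a nonzero constant and |u₀(r) u₁(r')| ≤ C h |W| for all r, r' with R ≤ r ≤ r'; equivalently, the resolvent kernel K(r,r') := −u₀(r) u₁(r')/(h² W) satisfies |K(r,r')| ≤ C/h for R ≤ r ≤ r'. -/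
open MeasureTheory Set Filter

/-- `R₀(V)`: the supremum of the essential support of `V : (0,∞) → ℝ`. -/
noncomputable def R0 (V : ℝ → ℝ) : ℝ :=
  sInf {R : ℝ | 0 ≤ R ∧ ∀ᵐ r ∂(volume.restrict (Ioi (0 : ℝ))), R < r → V r = 0}

/-- `M₀(V,E) = inf{ m > 0 : V(r) + m r⁻² - E ≥ 0 a.e. in a neighborhood of (0,R₀] }`. -/
noncomputable def M0 (V : ℝ → ℝ) (E : ℝ) : ℝ :=
  sInf {m : ℝ | 0 < m ∧ ∃ R' > R0 V,
    ∀ᵐ r ∂(volume.restrict (Ioi (0 : ℝ))), r < R' → 0 ≤ V r + m * (r ^ 2)⁻¹ - E}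

/-- `R₁(V,E) = (M₀(V,E)/E)^{1/2}`. -/
noncomputable def R1 (V : ℝ → ℝ) (E : ℝ) : ℝ := Real.sqrt (M0 V E / E)

/-- `M₊(E) = M₀(V,E) + E(R² - R₁(V,E)²)/2`. -/
noncomputable def Mplus (V : ℝ → ℝ) (R E : ℝ) : ℝ :=
  M0 V E + E * (R ^ 2 - (R1 V E) ^ 2) / 2

open scoped ComplexConjugate

theorem AbsolutelyContinuousOnInterval.congr_dist {f g : ℝ → ℂ} {a b : ℝ}
    (hf : AbsolutelyContinuousOnInterval f a b)
    (h : ∀ x ∈ uIcc a b, ∀ y ∈ uIcc a b, dist (g x) (g y) = dist (f x) (f y)) :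
    AbsolutelyContinuousOnInterval g a b := by
  rw [absolutelyContinuousOnInterval_iff] at hf ⊢
  intro ε hε
  obtain ⟨δ, hδ, H⟩ := hf ε hε
  refine ⟨δ, hδ, fun E hE hlen ↦ ?_⟩
  convert H E hE hlen using 1
  exact Finset.sum_congr rfl fun i hi ↦ h _ (hE.1 i hi).1 _ (hE.1 i hi).2

/-- The primitive of an interval integrable complex function is absolutely continuous. -/
theorem IntervalIntegrable.absolutelyContinuousOnInterval_primitive {f : ℝ → ℂ} {a b : ℝ}
    (hf : IntervalIntegrable f volume a b) (hab : a ≤ b) :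
    AbsolutelyContinuousOnInterval (fun x ↦ ∫ t in a..x, f t) a b := by
  have hre : IntervalIntegrable (fun t ↦ (f t).re) volume a b :=
    ⟨Complex.reCLM.integrable_comp hf.1, Complex.reCLM.integrable_comp hf.2⟩
  have him : IntervalIntegrable (fun t ↦ (f t).im) volume a b :=
    ⟨Complex.imCLM.integrable_comp hf.1, Complex.imCLM.integrable_comp hf.2⟩
  have hconst : ∀ z : ℂ, AbsolutelyContinuousOnInterval (fun _ : ℝ ↦ z) a b := fun z ↦
    (LipschitzWith.const z).lipschitzOnWith.absolutelyContinuousOnInterval (K := 0)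
  have key := ((hre.absolutelyContinuousOnInterval_intervalIntegral
      (c := a) left_mem_uIcc).fun_smul (hconst 1)).fun_add
    ((him.absolutelyContinuousOnInterval_intervalIntegral
      (c := a) left_mem_uIcc).fun_smul (hconst Complex.I))
  have heq : EqOn (fun x ↦ ∫ t in a..x, f t) (fun x ↦ (∫ t in a..x, (f t).re) • (1 : ℂ)
      + (∫ t in a..x, (f t).im) • Complex.I) (Icc a b) := by
    intro x hx
    have hfx : IntervalIntegrable f volume a x :=
      hf.mono_set (by rw [uIcc_of_le hx.1, uIcc_of_le hab]; exact Icc_subset_Icc_right hx.2)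
    have h1 := Complex.reCLM.intervalIntegral_comp_comm hfx
    have h2 := Complex.imCLM.intervalIntegral_comp_comm hfx
    simp only [Complex.reCLM_apply, Complex.imCLM_apply] at h1 h2
    simp only [h1, h2]
    apply Complex.ext <;> simp
  refine key.congr_dist fun x hx y hy ↦ ?_
  rw [uIcc_of_le hab] at hx hy
  exact congrArg₂ dist (heq hx) (heq hy)

namespace HasACDerivOn

variable {f f' g g' : ℝ → ℂ}

theorem ae_hasDerivAt (hf : HasACDerivOn f f') {a b : ℝ} (ha : 0 < a) (hab : a ≤ b) :
    ∀ᵐ x, x ∈ Ioo a b → HasDerivAt f (f' x) x := by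
  filter_upwards [(hf a b ha hab).1.ae_hasDerivAt_integral] with x hx hmem
  have h1 := (hx (by rw [uIcc_of_le hab]; exact Ioo_subset_Icc_self hmem) a
    left_mem_uIcc).const_add (f a)
  refine h1.congr_of_eventuallyEq ?_
  filter_upwards [Ioo_mem_nhds hmem.1 hmem.2] with y hy
  rw [← (hf a y ha hy.1.le).2]
  ring

theorem absolutelyContinuousOnInterval (hf : HasACDerivOn f f') {a b : ℝ} (ha : 0 < a)
    (hab : a ≤ b) : AbsolutelyContinuousOnInterval f a b := by
  refine ((hf a b ha hab).1.absolutelyContinuousOnInterval_primitive hab).congr_dist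
    fun x hx y hy ↦ ?_
  rw [uIcc_of_le hab] at hx hy
  rw [← (hf a _ ha hx.1).2, ← (hf a _ ha hy.1).2, dist_sub_right]

theorem continuousOn (hf : HasACDerivOn f f') : ContinuousOn f (Ioi 0) := by
  intro x hx
  have hx : 0 < x := hx
  have h := (hf.absolutelyContinuousOnInterval (half_pos hx)
    (by linarith : x / 2 ≤ x + 1)).continuousOn
  rw [uIcc_of_le (by linarith)] at h
  exact (h.continuousAt (Icc_mem_nhds (by linarith) (by linarith))).continuousWithinAt

theorem congr_ae (hf : HasACDerivOn f f')
    (h : ∀ᵐ x ∂(volume.restrict (Ioi (0 : ℝ))), f' x = g' x) : HasACDerivOn f g' := by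
  intro a b ha hab
  have h' : ∀ᵐ x, x ∈ uIoc a b → f' x = g' x := by
    filter_upwards [(ae_restrict_iff' measurableSet_Ioi).1 h] with x hx hmem
    rw [uIoc_of_le hab] at hmem
    exact hx (ha.trans hmem.1)
  refine ⟨(hf a b ha hab).1.congr_ae ((ae_restrict_iff' measurableSet_uIoc).2 h'), ?_⟩
  rw [(hf a b ha hab).2]
  exact intervalIntegral.integral_congr_ae h'

theorem of_hasDerivAt (hf : ∀ x, 0 < x → HasDerivAt f (f' x) x) (hc : ContinuousOn f' (Ioi 0)) :
    HasACDerivOn f f' := by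
  intro a b ha hab
  have hsub : uIcc a b ⊆ Ioi 0 := by
    rw [uIcc_of_le hab]
    exact fun x hx ↦ ha.trans_le hx.1
  have hi : IntervalIntegrable f' volume a b := (hc.mono hsub).intervalIntegrable
  exact ⟨hi, (intervalIntegral.integral_eq_sub_of_hasDerivAt (fun x hx ↦ hf x (hsub hx)) hi).symm⟩

/-- If the weak derivative agrees a.e. beyond `a` with a continuous function, then it is a
classical derivative there. -/
theorem hasDerivAt_of_ae_eq (hf : HasACDerivOn f f') {a : ℝ} (ha : 0 ≤ a)
    (hc : ContinuousOn g (Ioi a)) (h : ∀ᵐ x, a < x → f' x = g x) {r : ℝ} (hr : a < r) :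
    HasDerivAt f (g r) r := by
  set s := (a + r) / 2 with hs
  have has : a < s := by linarith
  have hsr : s < r := by linarith
  have hg : ContinuousAt g r := hc.continuousAt (Ioi_mem_nhds hr)
  have hsub : uIcc s r ⊆ Ioi a := by
    rw [uIcc_of_le hsr.le]
    exact fun x hx ↦ has.trans_le hx.1
  have hmeas : StronglyMeasurableAtFilter g (nhds r) volume :=
    hc.stronglyMeasurableAtFilter isOpen_Ioi _ hr
  have h1 := (intervalIntegral.integral_hasDerivAt_right (hc.mono hsub).intervalIntegrable
    hmeas hg).const_add (f s)
  refine h1.congr_of_eventuallyEq ?_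
  filter_upwards [Ioi_mem_nhds hsr] with y hy
  have hy : s < y := hy
  have h2 := (hf s y (by linarith) hy.le).2
  have h3 : ∫ x in s..y, f' x = ∫ x in s..y, g x := by
    apply intervalIntegral.integral_congr_ae
    filter_upwards [h] with x hx hmem
    rw [uIoc_of_le hy.le] at hmem
    exact hx (has.trans hmem.1)
  rw [← h3, ← h2]
  ring

theorem hasDerivAt (hf : HasACDerivOn f f') (hc : ContinuousOn f' (Ioi 0)) {r : ℝ} (hr : 0 < r) :
    HasDerivAt f (f' r) r :=
  hf.hasDerivAt_of_ae_eq le_rfl hc (ae_of_all _ fun _ _ ↦ rfl) hr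

theorem mul (hf : HasACDerivOn f f') (hg : HasACDerivOn g g') :
    HasACDerivOn (fun x ↦ f x * g x) (fun x ↦ f' x * g x + f x * g' x) := by
  intro a b ha hab
  have hsub : uIcc a b ⊆ Ioi 0 := by
    rw [uIcc_of_le hab]
    exact fun x hx ↦ ha.trans_le hx.1
  have hfg : IntervalIntegrable (fun x ↦ f' x * g x + f x * g' x) volume a b :=
    ((hf a b ha hab).1.mul_continuousOn (hg.continuousOn.mono hsub)).add
      ((hg a b ha hab).1.continuousOn_mul (hf.continuousOn.mono hsub))
  refine ⟨hfg, ?_⟩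
  have hac := ((hf.absolutelyContinuousOnInterval ha hab).fun_smul
    (hg.absolutelyContinuousOnInterval ha hab)).fun_sub
    (hfg.absolutelyContinuousOnInterval_primitive hab)
  obtain ⟨C, hC⟩ := hac.const_of_ae_hasDerivAt_zero (by
    have hna : ∀ᵐ x : ℝ, x ≠ a := by simp [ae_iff, measure_singleton]
    have hnb : ∀ᵐ x : ℝ, x ≠ b := by simp [ae_iff, measure_singleton]
    filter_upwards [hf.ae_hasDerivAt ha hab, hg.ae_hasDerivAt ha hab,
      hfg.ae_hasDerivAt_integral, hna, hnb] with x h1 h2 h3 h4 h5 hx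
    have hx' := hx
    rw [uIcc_of_le hab] at hx'
    have hmem : x ∈ Ioo a b := ⟨lt_of_le_of_ne hx'.1 h4.symm, lt_of_le_of_ne hx'.2 h5⟩
    have := ((h1 hmem).mul (h2 hmem)).sub (h3 hx a left_mem_uIcc)
    rw [sub_self] at this
    exact this)
  have e1 := hC a left_mem_uIcc
  have e2 := hC b right_mem_uIcc
  simp only [smul_eq_mul, intervalIntegral.integral_same, sub_zero] at e1 e2
  change f b * g b - f a * g a = _
  rw [e1, ← e2]
  ring

theorem sub (hf : HasACDerivOn f f') (hg : HasACDerivOn g g') :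
    HasACDerivOn (fun x ↦ f x - g x) (fun x ↦ f' x - g' x) := by
  intro a b ha hab
  obtain ⟨h1, h2⟩ := hf a b ha hab
  obtain ⟨h3, h4⟩ := hg a b ha hab
  refine ⟨h1.sub h3, ?_⟩
  rw [intervalIntegral.integral_sub h1 h3, ← h2, ← h4]
  ring

theorem complexConj (hf : HasACDerivOn f f') :
    HasACDerivOn (fun x ↦ conj (f x)) (fun x ↦ conj (f' x)) := by
  intro a b ha hab
  obtain ⟨h1, h2⟩ := hf a b ha hab
  refine ⟨⟨Complex.conjCLE.toContinuousLinearMap.integrable_comp h1.1,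
    Complex.conjCLE.toContinuousLinearMap.integrable_comp h1.2⟩, ?_⟩
  have := Complex.conjCLE.toContinuousLinearMap.intervalIntegral_comp_comm h1
  simp only [ContinuousLinearEquiv.coe_coe, Complex.conjCLE_apply] at this
  rw [this, ← h2, map_sub]

end HasACDerivOn
/-- `u` solves `u'' = Q u` on `(0,∞)`, with derivative `u'`. -/
structure SolvesODE (Q : ℝ → ℝ) (u u' : ℝ → ℂ) : Prop where
  fst : HasACDerivOn u u'
  snd : HasACDerivOn u' (fun r ↦ (Q r : ℂ) * u r)

namespace SolvesODE

variable {Q : ℝ → ℝ} {u u' v v' : ℝ → ℂ}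

theorem complexConj (hu : SolvesODE Q u u') :
    SolvesODE Q (fun r ↦ conj (u r)) (fun r ↦ conj (u' r)) :=
  ⟨hu.fst.complexConj, by simpa using hu.snd.complexConj⟩

theorem wronskian_hasACDerivOn {P : ℝ → ℝ} (hu : SolvesODE P u u') (hv : SolvesODE Q v v') :
    HasACDerivOn (fun r ↦ u r * v' r - u' r * v r)
      (fun r ↦ ((Q r - P r : ℝ) : ℂ) * (u r * v r)) := by
  refine ((hu.fst.mul hv.snd).sub (hu.snd.mul hv.fst)).congr_ae (ae_of_all _ fun r ↦ ?_)
  push_cast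
  ring

theorem wronskian_eq (hu : SolvesODE Q u u') (hv : SolvesODE Q v v') {r s : ℝ} (hr : 0 < r)
    (hs : 0 < s) : u r * v' r - u' r * v r = u s * v' s - u' s * v s := by
  have key : ∀ a b : ℝ, 0 < a → a ≤ b →
      u b * v' b - u' b * v b = u a * v' a - u' a * v a := by
    intro a b ha hab
    have := (hu.wronskian_hasACDerivOn hv a b ha hab).2
    simpa [sub_eq_zero] using this
  rcases le_total r s with h | h
  · exact (key r s hr h).symm
  · exact key s r hs h

/-- The flux `Im (conj u * u')` of a solution is constant. -/
theorem flux_eq (hu : SolvesODE Q u u') {r s : ℝ} (hr : 0 < r) (hs : 0 < s) :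
    (conj (u r) * u' r).im = (conj (u s) * u' s).im := by
  have := congrArg Complex.im (hu.complexConj.wronskian_eq hu hr hs)
  simp only [Complex.sub_im, Complex.mul_im, Complex.conj_re, Complex.conj_im] at this ⊢
  linarith

theorem hasDerivAt (hu : SolvesODE Q u u') {r : ℝ} (hr : 0 < r) : HasDerivAt u (u' r) r :=
  hu.fst.hasDerivAt hu.snd.continuousOn hr

/-- Backward uniqueness for the Cauchy problem. -/
theorem eq_zero_of_le (hu : SolvesODE Q u u')
    (hQ : ∀ a > 0, ∃ K, ∀ᵐ r, a < r → |Q r| ≤ K) {b : ℝ} (hb : u b = 0)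
    (hb' : u' b = 0) {r : ℝ} (hr : 0 < r) (hrb : r ≤ b) : u r = 0 := by
  obtain ⟨K₀, hK₀⟩ := hQ (r / 2) (half_pos hr)
  set a := r / 2 with ha
  have ha0 : 0 < a := half_pos hr
  have hsub : Ici a ⊆ Ioi (0 : ℝ) := fun x hx ↦ ha0.trans_le hx
  set K := 1 + |K₀| with hK
  set N : ℝ → ℝ := fun x ↦ ‖u x‖ + ‖u' x‖ with hN
  have hNc : ContinuousOn N (Ioi 0) := hu.fst.continuousOn.norm.add hu.snd.continuousOn.norm
  set Φ : ℝ → ℝ := fun x ↦ ∫ t in b..x, N t with hΦ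
  have hb0 : 0 < b := hr.trans_le hrb
  have hpos : ∀ {x y : ℝ}, 0 < x → 0 < y → uIcc x y ⊆ Ioi (0 : ℝ) := fun hx hy t ht ↦
    lt_of_lt_of_le (lt_min hx hy) ht.1
  have hΦd : ∀ x, 0 < x → HasDerivAt Φ (N x) x := fun x hx ↦
    intervalIntegral.integral_hasDerivAt_right (hNc.mono (hpos hb0 hx)).intervalIntegrable
      (hNc.stronglyMeasurableAtFilter isOpen_Ioi _ hx) (hNc.continuousAt (Ioi_mem_nhds hx))
  have hbound : ∀ x, a < x → x ≤ b → N x ≤ -(K * Φ x) := by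
    intro x hax hxb
    have hx0 : 0 < x := ha0.trans hax
    have hNi : IntervalIntegrable N volume x b := (hNc.mono (hpos hx0 hb0)).intervalIntegrable
    have e1 := (hu.fst x b hx0 hxb).2
    have e2 := (hu.snd x b hx0 hxb).2
    rw [hb, zero_sub] at e1
    rw [hb', zero_sub] at e2
    have n1 : ‖u x‖ ≤ ∫ t in x..b, N t := by
      rw [← norm_neg, e1]
      refine intervalIntegral.norm_integral_le_of_norm_le hxb (ae_of_all _ fun t _ ↦ ?_) hNi
      simp [hN]
    have n2 : ‖u' x‖ ≤ ∫ t in x..b, |K₀| * N t := by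
      rw [← norm_neg, e2]
      refine intervalIntegral.norm_integral_le_of_norm_le hxb ?_ (hNi.const_mul _)
      filter_upwards [hK₀] with t ht hmem
      rw [norm_mul, Complex.norm_real, Real.norm_eq_abs]
      have h1 := (ht (hax.trans hmem.1)).trans (le_abs_self K₀)
      have h2 : ‖u t‖ ≤ N t := by simp [hN]
      gcongr
    rw [intervalIntegral.integral_const_mul] at n2
    have : Φ x = -∫ t in x..b, N t := intervalIntegral.integral_symm x b
    rw [this]
    simp only [hN] at n1 n2 ⊢
    rw [hK]
    linarith
  have hmono : MonotoneOn (fun x ↦ -(Real.exp (K * x) * Φ x)) (Icc r b) := by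
    have hd : ∀ x, 0 < x → HasDerivAt (fun x ↦ -(Real.exp (K * x) * Φ x))
        (-(Real.exp (K * x) * (K * 1) * Φ x + Real.exp (K * x) * N x)) x := fun x hx ↦
      ((((hasDerivAt_id x).const_mul K).exp).mul (hΦd x hx)).neg
    refine monotoneOn_of_hasDerivWithinAt_nonneg (convex_Icc r b)
      (fun x hx ↦ (hd x (hr.trans_le hx.1)).continuousAt.continuousWithinAt)
      (fun x hx ↦ (hd x ?_).hasDerivWithinAt) fun x hx ↦ ?_
    · rw [interior_Icc] at hx
      exact hr.trans hx.1
    · rw [interior_Icc] at hx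
      have h1 := hbound x (by linarith [hx.1]) hx.2.le
      have h2 := mul_nonneg (Real.exp_pos (K * x)).le (by linarith : 0 ≤ -(K * Φ x + N x))
      linarith
  have h1 : -(Real.exp (K * r) * Φ r) ≤ -(Real.exp (K * b) * Φ b) :=
    hmono ⟨le_rfl, hrb⟩ ⟨hrb, le_rfl⟩ hrb
  have hΦb : Φ b = 0 := intervalIntegral.integral_same
  rw [hΦb, mul_zero, neg_zero, ← mul_neg] at h1
  have h2 : -Φ r ≤ 0 := nonpos_of_mul_nonpos_right h1 (Real.exp_pos _)
  have h3 := hbound r (by linarith) hrb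
  have h4 : K * -Φ r ≤ 0 := mul_nonpos_of_nonneg_of_nonpos (by positivity) h2
  have h5 : ‖u r‖ ≤ N r := by simp [hN]
  exact norm_le_zero_iff.1 (by linarith)

end SolvesODE
/-- A solution recessive at a regular singular point at the origin has zero flux. -/
theorem SolvesODE.flux_eq_zero_of_recessive {Q : ℝ → ℝ} {u u' : ℝ → ℂ} (hu : SolvesODE Q u u')
    {ν K δ C : ℝ} (hν : 0 ≤ ν) (hδ : 0 < δ)
    (hQ : ∀ᵐ r, 0 < r → |Q r - (ν ^ 2 - 1 / 4) * (r ^ 2)⁻¹| ≤ K)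
    (hrec : ∀ r ∈ Ioo 0 δ, ‖u r‖ ≤ C * r ^ (ν + 1 / 2)) {s : ℝ} (hs : 0 < s) :
    (conj (u s) * u' s).im = 0 := by
  set α := ν + 1 / 2 with hα
  set φ : ℝ → ℝ := fun r ↦ r ^ α with hφ
  set φ' : ℝ → ℝ := fun r ↦ α * r ^ (α - 1) with hφ'
  have hφd : ∀ r, 0 < r → HasDerivAt φ (φ' r) r := fun r hr ↦
    Real.hasDerivAt_rpow_const (Or.inl hr.ne')
  have hφd' : ∀ r, 0 < r → HasDerivAt φ' ((ν ^ 2 - 1 / 4) * (r ^ 2)⁻¹ * φ r) r := by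
    intro r hr
    have : r ^ (α - 1 - 1) = (r ^ 2)⁻¹ * r ^ α := by
      rw [show α - 1 - 1 = α - 2 by ring, Real.rpow_sub hr, Real.rpow_two]
      ring
    refine ((Real.hasDerivAt_rpow_const (p := α - 1) (Or.inl hr.ne')).const_mul α).congr_deriv ?_
    rw [this]
    simp only [hφ, hα]
    ring
  have hφpos : ∀ r, 0 < r → 0 < φ r := fun r hr ↦ Real.rpow_pos_of_pos hr _
  have hsolφ : SolvesODE (fun r ↦ (ν ^ 2 - 1 / 4) * (r ^ 2)⁻¹) (fun r ↦ (φ r : ℂ))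
      (fun r ↦ (φ' r : ℂ)) := by
    constructor
    · refine HasACDerivOn.of_hasDerivAt (fun r hr ↦ (hφd r hr).ofReal_comp) fun r hr ↦ ?_
      exact (hφd' r hr).ofReal_comp.continuousAt.continuousWithinAt
    · refine HasACDerivOn.of_hasDerivAt (fun r hr ↦ ?_) fun r hr ↦ ?_
      · simpa using (hφd' r hr).ofReal_comp
      · refine ContinuousAt.continuousWithinAt ?_
        have hr0 : r ^ 2 ≠ 0 := pow_ne_zero 2 (ne_of_gt hr)
        have h1 : ContinuousAt (fun r : ℝ ↦ (ν ^ 2 - 1 / 4) * (r ^ 2)⁻¹ * φ r) r :=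
          (continuousAt_const.mul ((continuousAt_id.pow 2).inv₀ hr0)).mul (hφd r hr).continuousAt
        refine (Complex.continuous_ofReal.continuousAt.comp h1).congr (.of_forall fun x ↦ ?_)
        exact Complex.ofReal_mul _ _
  set g : ℝ → ℂ := fun r ↦ (φ r : ℂ) * u' r - (φ' r : ℂ) * u r with hg
  set η := min δ 1 with hη
  have hη0 : 0 < η := lt_min hδ one_pos
  have hrec' : ∀ r, 0 < r → r < η → ‖u r‖ ≤ C * φ r := fun r h1 h2 ↦
    hrec r ⟨h1, h2.trans_le (min_le_left _ _)⟩
  have hC : 0 ≤ C := by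
    have := (norm_nonneg _).trans (hrec' (η / 2) (by linarith) (by linarith))
    exact nonneg_of_mul_nonneg_left this (hφpos _ (by linarith))
  have hφ1 : ∀ r, 0 < r → r < η → φ r ≤ 1 := fun r h1 h2 ↦
    Real.rpow_le_one h1.le (h2.le.trans (min_le_right _ _)) (by linarith)
  have hφsq : ∀ r, 0 < r → r < η → φ r ^ 2 ≤ r := by
    intro r h1 h2
    have : φ r ^ 2 = r ^ (2 * α) := by
      rw [hφ, ← Real.rpow_natCast, ← Real.rpow_mul h1.le]
      norm_num [mul_comm]
    rw [this]
    calc r ^ (2 * α) ≤ r ^ (1 : ℝ) :=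
          Real.rpow_le_rpow_of_exponent_ge h1 (h2.le.trans (min_le_right _ _)) (by linarith)
      _ = r := Real.rpow_one r
  set L := |K| * C with hL
  have hL0 : 0 ≤ L := mul_nonneg (abs_nonneg _) hC
  have hglip : ∀ a b, 0 < a → a ≤ b → b < η → ‖g b - g a‖ ≤ L * b := by
    intro a b ha hab hb
    rw [(hsolφ.wronskian_hasACDerivOn hu a b ha hab).2]
    have : ‖∫ x in a..b, ((Q x - (ν ^ 2 - 1 / 4) * (x ^ 2)⁻¹ : ℝ) : ℂ) * ((φ x : ℂ) * u x)‖
        ≤ L * |b - a| := by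
      refine intervalIntegral.norm_integral_le_of_norm_le_const_ae ?_
      filter_upwards [hQ] with x hx hmem
      rw [uIoc_of_le hab] at hmem
      have hx0 : 0 < x := ha.trans hmem.1
      have hxη : x < η := hmem.2.trans_lt hb
      rw [norm_mul, norm_mul, Complex.norm_real, Complex.norm_real, Real.norm_eq_abs,
        Real.norm_eq_abs, abs_of_pos (hφpos x hx0)]
      have h1 : ‖u x‖ ≤ C := (hrec' x hx0 hxη).trans (mul_le_of_le_one_right hC (hφ1 x hx0 hxη))
      have h2 : φ x * ‖u x‖ ≤ C :=
        (mul_le_of_le_one_left (norm_nonneg _) (hφ1 x hx0 hxη)).trans h1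
      exact mul_le_mul ((hx hx0).trans (le_abs_self K)) h2
        (mul_nonneg (hφpos x hx0).le (norm_nonneg _)) (abs_nonneg _)
    refine this.trans (mul_le_mul_of_nonneg_left ?_ hL0)
    rw [abs_of_nonneg (by linarith)]
    linarith
  have hgb : ∀ b, 0 < b → b < η → ‖g b‖ ≤ 2 * L * b := by
    intro b hb hbη
    by_contra! hlt
    set c := g b with hc
    have hc0 : 0 < ‖c‖ := lt_of_le_of_lt (by positivity) hlt
    have hre : ∀ r, 0 < r → r ≤ b → ‖c‖ ^ 2 / 2 ≤ (conj c * g r).re := by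
      intro r hr hrb
      have h1 := hglip r b hr hrb hbη
      have h2 : (conj c * g r).re = ‖c‖ ^ 2 - (conj c * (c - g r)).re := by
        rw [← Complex.normSq_eq_norm_sq, Complex.normSq_apply]
        simp
        ring
      have h3 : (conj c * (c - g r)).re ≤ ‖c‖ * (L * b) := by
        refine (Complex.re_le_norm _).trans ?_
        rw [norm_mul, Complex.norm_conj]
        exact mul_le_mul_of_nonneg_left h1 hc0.le
      nlinarith
    set ψ : ℝ → ℝ := fun r ↦ (conj c * (u r / (φ r : ℂ))).re - ‖c‖ ^ 2 / 2 * Real.log r with hψ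
    have hψd : ∀ r, 0 < r → HasDerivAt ψ ((conj c * g r).re / φ r ^ 2 - ‖c‖ ^ 2 / 2 * r⁻¹) r := by
      intro r hr
      have hne : (φ r : ℂ) ≠ 0 := by exact_mod_cast (hφpos r hr).ne'
      have h1 := ((hu.hasDerivAt hr).div (hφd r hr).ofReal_comp hne).const_mul (conj c)
      have h2 := Complex.reCLM.hasFDerivAt.comp_hasDerivAt r h1
      refine (h2.sub ((Real.hasDerivAt_log hr.ne').const_mul (‖c‖ ^ 2 / 2))).congr_deriv ?_
      rw [Complex.reCLM_apply, ← Complex.ofReal_pow, ← mul_div_assoc, Complex.div_ofReal_re, hg]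
      congr 2
      ring_nf
    have hmono : MonotoneOn ψ (Ioc 0 b) := by
      refine monotoneOn_of_hasDerivWithinAt_nonneg (convex_Ioc 0 b)
        (fun x hx ↦ (hψd x hx.1).continuousAt.continuousWithinAt)
        (fun x hx ↦ (hψd x ?_).hasDerivWithinAt) fun x hx ↦ ?_
      · rw [interior_Ioc] at hx
        exact hx.1
      · rw [interior_Ioc] at hx
        have h1 := hre x hx.1 hx.2.le
        have h2 := hφsq x hx.1 (hx.2.trans hbη)
        have h3 : 0 < φ x ^ 2 := pow_pos (hφpos x hx.1) 2
        have h0 : 0 ≤ (conj c * g x).re := le_trans (by positivity) h1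
        have h4 : ‖c‖ ^ 2 / 2 / x ≤ (conj c * g x).re / φ x ^ 2 := by gcongr
        rw [← div_eq_mul_inv]
        linarith
    have hlow : ∀ r, 0 < r → r ≤ b → -(‖c‖ * C) - ‖c‖ ^ 2 / 2 * Real.log r ≤ ψ b := by
      intro r hr hrb
      refine le_trans ?_ (hmono ⟨hr, hrb⟩ ⟨hb, le_rfl⟩ hrb)
      have h1 : ‖conj c * (u r / (φ r : ℂ))‖ ≤ ‖c‖ * C := by
        rw [norm_mul, Complex.norm_conj, norm_div, Complex.norm_real, Real.norm_eq_abs,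
          abs_of_pos (hφpos r hr)]
        refine mul_le_mul_of_nonneg_left ?_ hc0.le
        rw [div_le_iff₀ (hφpos r hr)]
        exact hrec' r hr (hrb.trans_lt hbη)
      have h2 := (abs_le.1 ((Complex.abs_re_le_norm _).trans h1)).1
      simp only [hψ]
      linarith
    have hlim : Tendsto (fun r ↦ -(‖c‖ * C) - ‖c‖ ^ 2 / 2 * Real.log r)
        (nhdsWithin 0 (Ioi 0)) atTop := by
      have := (Real.tendsto_log_nhdsGT_zero.const_mul_atBot
        (by positivity : 0 < ‖c‖ ^ 2 / 2))
      simpa [sub_eq_add_neg] using tendsto_atTop_add_const_left _ (-(‖c‖ * C))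
        (tendsto_neg_atBot_atTop.comp this)
    have hev := (hlim.eventually_gt_atTop (ψ b)).and (Ioc_mem_nhdsGT hb)
    obtain ⟨r, h1, h2⟩ := hev.exists
    linarith [hlow r h2.1 h2.2]
  set G := (conj (u s) * u' s).im with hG
  have hbd : ∀ r, 0 < r → r < η → |G| ≤ C * (2 * L) * r := by
    intro r hr hrη
    have hGr : G = (conj (u r) * u' r).im := hu.flux_eq hs hr
    have h1 : φ r * G = (conj (u r) * g r).im := by
      rw [hGr, hg]
      simp
      ring
    have h2 : φ r * |G| ≤ C * φ r * (2 * L * r) := by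
      rw [← abs_of_pos (hφpos r hr), ← abs_mul, abs_of_pos (hφpos r hr), h1]
      refine (Complex.abs_im_le_norm _).trans ?_
      rw [norm_mul, Complex.norm_conj]
      exact mul_le_mul (hrec' r hr hrη) (hgb r hr hrη) (norm_nonneg _)
        (mul_nonneg hC (hφpos r hr).le)
    exact le_of_mul_le_mul_left (by linarith) (hφpos r hr)
  have hlim : Tendsto (fun r : ℝ ↦ C * (2 * L) * r) (nhdsWithin 0 (Ioi 0)) (nhds 0) := by
    have : Tendsto (fun r : ℝ ↦ C * (2 * L) * r) (nhds 0) (nhds (C * (2 * L) * 0)) :=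
      tendsto_id.const_mul _
    rw [mul_zero] at this
    exact this.mono_left nhdsWithin_le_nhds
  have : |G| ≤ 0 := ge_of_tendsto hlim (by
    filter_upwards [Ioo_mem_nhdsGT hη0] with r hr using hbd r hr.1 hr.2)
  exact abs_nonpos_iff.1 this

/-- Where the potential is `m / r²` and the classically allowed region has kinetic energy at least
`c`, an outgoing solution is controlled by its flux. -/
theorem norm_sq_le_flux_of_outgoing {a h m E c J C₁ : ℝ} {u u' : ℝ → ℂ} (ha : 0 ≤ a) (hh : 0 < h)
    (hE : 0 < E) (hc : 0 < c) (hcE : c ≤ E)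
    (hcm : ∀ r, a < r → c ≤ E - m * (r ^ 2)⁻¹)
    (hu : ∀ r, a < r → HasDerivAt u (u' r) r)
    (hu' : ∀ r, a < r → HasDerivAt u' ((((m * (r ^ 2)⁻¹ - E) / h ^ 2 : ℝ) : ℂ) * u r) r)
    (hJ : ∀ r, a < r → (conj (u r) * u' r).im = J)
    (hbdd : ∀ r, 1 ≤ r → ‖u r‖ ≤ C₁)
    (hout : Tendsto (fun r : ℝ ↦ u' r - Complex.I * (Real.sqrt E / h : ℝ) * u r) atTop (nhds 0))
    {r : ℝ} (hr : a < r) : c * ‖u r‖ ^ 2 ≤ 2 * Real.sqrt E * (h * J) := by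
  set p : ℝ → ℝ := fun r ↦ E - m * (r ^ 2)⁻¹ with hp
  set F : ℝ → ℝ := fun r ↦ h ^ 2 * ((u' r).re ^ 2 + (u' r).im ^ 2)
    + p r * ((u r).re ^ 2 + (u r).im ^ 2) with hF
  have hnorm : ∀ z : ℂ, ‖z‖ ^ 2 = z.re ^ 2 + z.im ^ 2 := fun z ↦ by
    rw [← Complex.normSq_eq_norm_sq, Complex.normSq_apply]
    ring
  have hpd : ∀ r, a < r → HasDerivAt p (m * (2 * (r ^ 3)⁻¹)) r := by
    intro r hr
    have hr0 : r ≠ 0 := (ha.trans_lt hr).ne'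
    refine ((((hasDerivAt_pow 2 r).fun_inv (pow_ne_zero 2 hr0)).const_mul m).const_sub
      E).congr_deriv ?_
    field_simp
    ring
  have hFd : ∀ r, a < r →
      HasDerivAt F (m * (2 * (r ^ 3)⁻¹) * ((u r).re ^ 2 + (u r).im ^ 2)) r := by
    intro r hr
    have d1 : HasDerivAt (fun r ↦ (u r).re) (u' r).re r :=
      Complex.reCLM.hasFDerivAt.comp_hasDerivAt r (hu r hr)
    have d2 : HasDerivAt (fun r ↦ (u r).im) (u' r).im r :=
      Complex.imCLM.hasFDerivAt.comp_hasDerivAt r (hu r hr)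
    have d3 : HasDerivAt (fun r ↦ (u' r).re) ((m * (r ^ 2)⁻¹ - E) / h ^ 2 * (u r).re) r :=
      (Complex.reCLM.hasFDerivAt.comp_hasDerivAt r (hu' r hr)).congr_deriv (by
        rw [Complex.reCLM_apply, Complex.re_ofReal_mul])
    have d4 : HasDerivAt (fun r ↦ (u' r).im) ((m * (r ^ 2)⁻¹ - E) / h ^ 2 * (u r).im) r :=
      (Complex.imCLM.hasFDerivAt.comp_hasDerivAt r (hu' r hr)).congr_deriv (by
        rw [Complex.imCLM_apply, Complex.im_ofReal_mul])
    refine (((d3.fun_pow 2).fun_add (d4.fun_pow 2)).const_mul (h ^ 2) |>.fun_add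
      ((hpd r hr).fun_mul ((d1.fun_pow 2).fun_add (d2.fun_pow 2)))).congr_deriv ?_
    simp only [hp]
    field_simp
    ring
  set k := 2 * Real.sqrt E * (h * J) with hk
  have hid : ∀ r, a < r → F r - k =
      h ^ 2 * ‖u' r - Complex.I * (Real.sqrt E / h : ℝ) * u r‖ ^ 2 - m * (r ^ 2)⁻¹ * ‖u r‖ ^ 2 := by
    intro r hr
    rw [hk, ← hJ r hr, hnorm, hnorm]
    simp only [hF, hp, Complex.sub_re, Complex.sub_im, Complex.mul_re, Complex.mul_im, Complex.I_re,
      Complex.I_im, Complex.ofReal_re, Complex.ofReal_im, Complex.conj_re, Complex.conj_im]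
    have hsq := Real.sq_sqrt hE.le
    set q := Real.sqrt E
    rw [← hsq]
    field_simp
    ring
  have hinv : Tendsto (fun r : ℝ ↦ m * (r ^ 2)⁻¹) atTop (nhds 0) := by
    simpa using ((tendsto_pow_atTop two_ne_zero).inv_tendsto_atTop (𝕜 := ℝ)).const_mul m
  have hFlim : Tendsto F atTop (nhds k) := by
    have h1 : Tendsto (fun r ↦ h ^ 2 * ‖u' r - Complex.I * (Real.sqrt E / h : ℝ) * u r‖ ^ 2)
        atTop (nhds 0) := by
      simpa using (hout.norm.pow 2).const_mul (h ^ 2)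
    have h2 : Tendsto (fun r ↦ m * (r ^ 2)⁻¹ * ‖u r‖ ^ 2) atTop (nhds 0) := by
      refine hinv.zero_mul_isBoundedUnder_le
        (isBoundedUnder_of_eventually_le (a := C₁ ^ 2) ?_)
      filter_upwards [eventually_ge_atTop 1] with r hr
      simp only [Function.comp_apply, norm_pow, norm_norm]
      have := hbdd r hr
      gcongr
    have h3 := (h1.sub h2).const_add k
    rw [sub_zero, add_zero] at h3
    refine h3.congr' ?_
    filter_upwards [eventually_gt_atTop a] with r hr
    rw [← hid r hr]
    ring
  have hpr : c ≤ p r := hcm r hr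
  have hFge : p r * ‖u r‖ ^ 2 ≤ F r := by
    rw [hnorm]
    simp only [hF]
    have : 0 ≤ h ^ 2 * ((u' r).re ^ 2 + (u' r).im ^ 2) := by positivity
    linarith
  have hcu : c * ‖u r‖ ^ 2 ≤ p r * ‖u r‖ ^ 2 := by gcongr
  have hle : ∀ f : ℝ → ℝ, ∀ l, MonotoneOn f (Ioi a) → Tendsto f atTop (nhds l) → f r ≤ l :=
    fun f l hmono hlim ↦ ge_of_tendsto hlim (by
      filter_upwards [eventually_ge_atTop r] with s hs
      exact hmono hr (hr.trans_le hs) hs)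
  rcases le_total 0 m with hm | hm
  · refine hcu.trans (hFge.trans (hle F k ?_ hFlim))
    refine monotoneOn_of_hasDerivWithinAt_nonneg (convex_Ioi a)
      (fun x hx ↦ (hFd x hx).continuousAt.continuousWithinAt)
      (fun x hx ↦ (hFd x (by rwa [interior_Ioi] at hx)).hasDerivWithinAt) fun x hx ↦ ?_
    rw [interior_Ioi] at hx
    have : 0 < x := ha.trans_lt hx
    positivity
  · have hp0 : ∀ x, a < x → 0 < p x := fun x hx ↦ hc.trans_le (hcm x hx)
    have hqd : ∀ x, a < x → HasDerivAt (fun x ↦ F x / p x)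
        (-(m * (2 * (x ^ 3)⁻¹)) * (h ^ 2 * ((u' x).re ^ 2 + (u' x).im ^ 2)) / p x ^ 2) x := by
      intro x hx
      refine ((hFd x hx).div (hpd x hx) (hp0 x hx).ne').congr_deriv ?_
      simp only [hF]
      congr 1
      ring
    have hmono : MonotoneOn (fun x ↦ F x / p x) (Ioi a) := by
      refine monotoneOn_of_hasDerivWithinAt_nonneg (convex_Ioi a)
        (fun x hx ↦ (hqd x hx).continuousAt.continuousWithinAt)
        (fun x hx ↦ (hqd x (by rwa [interior_Ioi] at hx)).hasDerivWithinAt) fun x hx ↦ ?_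
      rw [interior_Ioi] at hx
      have hx0 : 0 < x := ha.trans_lt hx
      have : 0 ≤ -(m * (2 * (x ^ 3)⁻¹)) := by
        rw [← neg_mul]
        exact mul_nonneg (by linarith) (by positivity)
      positivity
    have hplim : Tendsto p atTop (nhds E) := by simpa using hinv.const_sub E
    have h1 := hle _ _ hmono (hFlim.div hplim hE.ne')
    have hpr0 := hp0 r hr
    have h2 : ‖u r‖ ^ 2 ≤ F r / p r := by
      rw [le_div_iff₀ hpr0]
      linarith
    have h3 := h2.trans h1
    rw [le_div_iff₀ hE] at h3
    have h4 : c * ‖u r‖ ^ 2 ≤ E * ‖u r‖ ^ 2 := by gcongr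
    linarith

theorem ae_restrict_Ioi_zero_iff {P : ℝ → Prop} :
    (∀ᵐ r ∂(volume.restrict (Ioi (0 : ℝ))), P r) ↔ ∀ᵐ r, 0 < r → P r :=
  ae_restrict_iff' measurableSet_Ioi

section PotentialConstants

variable {V : ℝ → ℝ}

theorem exists_lt_ae_eq_zero_of_R0_lt (hV : HasCompactSupport V) {a : ℝ} (ha : R0 V < a) :
    ∃ b < a, R0 V ≤ b ∧ 0 ≤ b ∧ ∀ᵐ r, b < r → V r = 0 := by
  have hne : {R : ℝ | 0 ≤ R ∧ ∀ᵐ r ∂(volume.restrict (Ioi (0 : ℝ))), R < r → V r = 0}.Nonempty := by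
    obtain ⟨B, hB⟩ := hV.isCompact.bddAbove
    refine ⟨max B 0, le_max_right _ _, ae_of_all _ fun r hr ↦ ?_⟩
    by_contra h
    exact absurd (hB (subset_tsupport V h)) (not_le.2 ((le_max_left _ _).trans_lt hr))
  obtain ⟨b, ⟨hb0, hb⟩, hba⟩ := exists_lt_of_csInf_lt hne ha
  refine ⟨b, hba, csInf_le ⟨0, fun x hx ↦ hx.1⟩ ⟨hb0, hb⟩, hb0, ?_⟩
  filter_upwards [ae_restrict_Ioi_zero_iff.1 hb] with r hr hbr
  exact hr (hb0.trans_lt hbr) hbr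

theorem M0_mem_of_bound {K E : ℝ} (hR0 : 0 < R0 V) (hK : 0 ≤ K) (hE : 0 < E)
    (hV : ∀ᵐ r, 0 < r → |V r| ≤ K) :
    (K + E) * (R0 V + 1) ^ 2 ∈ {m : ℝ | 0 < m ∧ ∃ R' > R0 V,
      ∀ᵐ r ∂(volume.restrict (Ioi (0 : ℝ))), r < R' → 0 ≤ V r + m * (r ^ 2)⁻¹ - E} := by
  refine ⟨by positivity, R0 V + 1, by linarith, ae_restrict_Ioi_zero_iff.2 ?_⟩
  filter_upwards [hV] with r hr hr0 hrR
  have h1 := (abs_le.1 (hr hr0)).1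
  have h2 : K + E ≤ (K + E) * (R0 V + 1) ^ 2 * (r ^ 2)⁻¹ := by
    rw [← div_eq_mul_inv, le_div_iff₀ (by positivity)]
    gcongr
  linarith

theorem M0_nonneg (V : ℝ → ℝ) (E : ℝ) : 0 ≤ M0 V E :=
  Real.sInf_nonneg fun _ hx ↦ hx.1.le

theorem M0_le {K E : ℝ} (hR0 : 0 < R0 V) (hK : 0 ≤ K) (hE : 0 < E)
    (hV : ∀ᵐ r, 0 < r → |V r| ≤ K) : M0 V E ≤ (K + E) * (R0 V + 1) ^ 2 :=
  csInf_le ⟨0, fun _ hx ↦ hx.1.le⟩ (M0_mem_of_bound hR0 hK hE hV)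

theorem le_M0 {K E : ℝ} (hsupp : HasCompactSupport V) (hR0 : 0 < R0 V) (hK : 0 ≤ K) (hE : 0 < E)
    (hV : ∀ᵐ r, 0 < r → |V r| ≤ K) : E * R0 V ^ 2 ≤ M0 V E := by
  refine le_csInf ⟨_, M0_mem_of_bound hR0 hK hE hV⟩ ?_
  rintro m ⟨-, R', hR', hm⟩
  obtain ⟨b, hbR', hb, hb0, hVb⟩ := exists_lt_ae_eq_zero_of_R0_lt hsupp hR'
  have hpos : volume (Ioo b R') ≠ 0 := by simpa using hbR'
  have hae : ∀ᵐ r, r ∈ Ioo b R' → E * R0 V ^ 2 ≤ m := by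
    filter_upwards [hVb, ae_restrict_Ioi_zero_iff.1 hm] with r h1 h2 hr
    have hr0 : 0 < r := hb0.trans_lt hr.1
    have h3 := h2 hr0 hr.2
    rw [h1 hr.1, zero_add, sub_nonneg, ← div_eq_mul_inv, le_div_iff₀ (by positivity)] at h3
    refine le_trans ?_ h3
    have : R0 V ≤ r := hb.trans hr.1.le
    gcongr
  by_contra hcon
  refine hpos (measure_mono_null (fun r hr ↦ ?_) hae)
  exact fun h ↦ hcon (h hr)

theorem R1_sq {E : ℝ} (hE : 0 < E) : R1 V E ^ 2 = M0 V E / E :=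
  Real.sq_sqrt (div_nonneg (M0_nonneg V E) hE.le)

end PotentialConstants

theorem SolvesODE.of_equation {h E m : ℝ} {V : ℝ → ℝ} {u u' u'' : ℝ → ℂ} (hh : 0 < h)
    (h1 : HasACDerivOn u u') (h2 : HasACDerivOn u' u'')
    (heq : ∀ᵐ r ∂(volume.restrict (Ioi (0 : ℝ))),
      -(h : ℂ) ^ 2 * u'' r + ((V r + m * (r ^ 2)⁻¹ - E : ℝ) : ℂ) * u r = 0) :
    SolvesODE (fun r ↦ (V r + m * (r ^ 2)⁻¹ - E) / h ^ 2) u u' := by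
  refine ⟨h1, h2.congr_ae ?_⟩
  filter_upwards [heq] with r hr
  have hne : (h : ℂ) ≠ 0 := by exact_mod_cast hh.ne'
  rw [Complex.ofReal_div, div_mul_eq_mul_div, eq_div_iff (by simpa using hne)]
  push_cast at hr ⊢
  linear_combination -hr

/-- The flux of a flux-free solution against an outgoing one bounds the Wronskian from below. -/
theorem norm_mul_flux_le {z z' w w' : ℂ} (hz : (conj z * z').im = 0) :
    ‖z‖ * (conj w * w').im ≤ ‖w‖ * ‖z * w' - z' * w‖ := by
  rcases eq_or_ne z 0 with rfl | hne
  · simpa using mul_nonneg (norm_nonneg w) (norm_nonneg (z' * w))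
  have hid : (conj z * (conj w * (z * w' - z' * w))).im = ‖z‖ ^ 2 * (conj w * w').im := by
    rw [← sub_zero (‖z‖ ^ 2 * _), ← mul_zero (‖w‖ ^ 2), ← hz, ← Complex.normSq_eq_norm_sq,
      ← Complex.normSq_eq_norm_sq, Complex.normSq_apply, Complex.normSq_apply]
    simp
    ring
  have hle := (le_abs_self _).trans
    (Complex.abs_im_le_norm (conj z * (conj w * (z * w' - z' * w))))
  rw [hid, norm_mul, norm_mul, Complex.norm_conj, Complex.norm_conj] at hle
  have hz0 : 0 < ‖z‖ := norm_pos_iff.2 hne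
  refine le_of_mul_le_mul_left ?_ hz0
  linarith

/-- Kernel bound `|K(r,r')| ≤ C/h` in the exterior region `R ≤ r ≤ r'`, for
angular momenta `-h²/4 ≤ m ≤ M₊(E)`. -/
theorem kernel_bound_exterior_small_m
    (Emin Emax : ℝ) (hEmin : 0 < Emin) (hE : Emin ≤ Emax)
    (V : ℝ → ℝ) (hVmeas : Measurable V)
    (hVbdd : ∃ Cv : ℝ, ∀ᵐ r ∂(volume.restrict (Ioi (0 : ℝ))), |V r| ≤ Cv)
    (hVsupp : HasCompactSupport V) (hR0 : 0 < R0 V)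
    (R : ℝ) (hR : sSup ((fun E => R1 V E) '' Icc Emin Emax) < R) :
    ∃ C > (0 : ℝ), ∃ h₀ > (0 : ℝ), ∀ h ∈ Ioc (0 : ℝ) h₀, ∀ E ∈ Icc Emin Emax,
      ∀ m ∈ Icc (-h ^ 2 / 4) (Mplus V R E),
      ∀ ν : ℝ, ν = Real.sqrt (m + h ^ 2 / 4) / h →
      ∀ u₀ u₀' u₀'' u₁ u₁' u₁'' : ℝ → ℂ,
      HasACDerivOn u₀ u₀' → HasACDerivOn u₀' u₀'' →
      (∀ᵐ r ∂(volume.restrict (Ioi (0 : ℝ))),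
        -(h : ℂ) ^ 2 * u₀'' r + ((V r + m * (r ^ 2)⁻¹ - E : ℝ) : ℂ) * u₀ r = 0) →
      (∃ r ∈ Ioi (0 : ℝ), u₀ r ≠ 0) →
      (∃ δ > (0 : ℝ), ∃ C₀ : ℝ, ∀ r ∈ Ioo (0 : ℝ) δ, ‖u₀ r‖ ≤ C₀ * r ^ (ν + 1 / 2)) →
      HasACDerivOn u₁ u₁' → HasACDerivOn u₁' u₁'' →
      (∀ᵐ r ∂(volume.restrict (Ioi (0 : ℝ))),
        -(h : ℂ) ^ 2 * u₁'' r + ((V r + m * (r ^ 2)⁻¹ - E : ℝ) : ℂ) * u₁ r = 0) →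
      (∃ r ∈ Ioi (0 : ℝ), u₁ r ≠ 0) →
      (∃ C₁ : ℝ, ∀ r : ℝ, 1 ≤ r → ‖u₁ r‖ ≤ C₁) →
      Tendsto (fun r : ℝ => u₁' r - Complex.I * (Real.sqrt E / h : ℝ) * u₁ r)
        atTop (nhds 0) →
      ((∀ r ∈ Ioi (0 : ℝ), ∀ r' ∈ Ioi (0 : ℝ),
          u₀ r * u₁' r - u₀' r * u₁ r = u₀ r' * u₁' r' - u₀' r' * u₁ r') ∧
        (∀ r ∈ Ioi (0 : ℝ), u₀ r * u₁' r - u₀' r * u₁ r ≠ 0) ∧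
        ∀ r r' : ℝ, R ≤ r → r ≤ r' →
          ‖u₀ r * u₁ r'‖ ≤ C * h * ‖u₀ r * u₁' r - u₀' r * u₁ r‖) := by
  obtain ⟨K₀, hK₀⟩ := hVbdd
  set K := |K₀| with hK
  have hK0 : 0 ≤ K := abs_nonneg _
  have hVK : ∀ᵐ r, 0 < r → |V r| ≤ K := by
    filter_upwards [ae_restrict_Ioi_zero_iff.1 hK₀] with r hr h0
    exact (hr h0).trans (le_abs_self _)
  set S := sSup ((fun E ↦ R1 V E) '' Icc Emin Emax) with hS
  have hbdd : BddAbove ((fun E ↦ R1 V E) '' Icc Emin Emax) := by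
    refine ⟨Real.sqrt ((K + Emax) * (R0 V + 1) ^ 2 / Emin), ?_⟩
    rintro _ ⟨E, hEm, rfl⟩
    have hE0 : 0 < E := hEmin.trans_le hEm.1
    have h1 := M0_le hR0 hK0 hE0 hVK
    refine Real.sqrt_le_sqrt ?_
    have h2 : M0 V E ≤ (K + Emax) * (R0 V + 1) ^ 2 := h1.trans (by gcongr; exact hEm.2)
    have h3 := hEm.1
    have h4 : 0 ≤ (K + Emax) * (R0 V + 1) ^ 2 := (M0_nonneg V E).trans h2
    gcongr
  have hRS : ∀ E ∈ Icc Emin Emax, R1 V E ≤ S := fun E hEm ↦ le_csSup hbdd ⟨E, hEm, rfl⟩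
  have hS0 : R0 V ≤ S := by
    refine le_trans (Real.le_sqrt_of_sq_le ?_) (hRS Emin ⟨le_rfl, hE⟩)
    rw [le_div_iff₀ hEmin, mul_comm]
    exact le_M0 hVsupp hR0 hK0 hEmin hVK
  have hSpos : 0 < S := hR0.trans_le hS0
  have hRpos : 0 < R := hSpos.trans hR
  obtain ⟨a, haR, -, ha0, hVa⟩ := exists_lt_ae_eq_zero_of_R0_lt hVsupp (hS0.trans_lt hR)
  set θ := (R ^ 2 - S ^ 2) / (S ^ 2 + 3 * R ^ 2) with hθ
  have hden : 0 < S ^ 2 + 3 * R ^ 2 := by positivity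
  have hSR : S ^ 2 < R ^ 2 := by gcongr
  have hθ0 : 0 < θ := div_pos (by linarith) hden
  have hθ1 : θ ≤ 1 := by
    rw [hθ, div_le_one hden]
    nlinarith [sq_nonneg S, sq_nonneg R]
  set c := Emin * θ with hc
  have hc0 : 0 < c := mul_pos hEmin hθ0
  set ρ := max a (Real.sqrt ((S ^ 2 + 3 * R ^ 2) / 4)) with hρ
  have hρ0 : 0 ≤ ρ := ha0.trans (le_max_left _ _)
  have hρR : ρ < R := max_lt haR (by
    rw [Real.sqrt_lt' hRpos]
    linarith)
  have hEmax : 0 < Emax := hEmin.trans_le hE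
  refine ⟨2 * Real.sqrt Emax / c, div_pos (by positivity) hc0, 1, one_pos, ?_⟩
  intro h hh E hEm m hm ν hν u₀ u₀' u₀'' u₁ u₁' u₁'' h0 h0' heq0 hne0 hrec h1 h1' heq1 hne1 hb1 hout
  obtain ⟨hh, -⟩ := hh
  have hE0 : 0 < E := hEmin.trans_le hEm.1
  have hs0 := SolvesODE.of_equation hh h0 h0' heq0
  have hs1 := SolvesODE.of_equation hh h1 h1' heq1
  set Q : ℝ → ℝ := fun r ↦ (V r + m * (r ^ 2)⁻¹ - E) / h ^ 2 with hQ
  have hflux0 : ∀ r, 0 < r → (conj (u₀ r) * u₀' r).im = 0 := by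
    obtain ⟨δ, hδ, C₀, hC₀⟩ := hrec
    have hν0 : 0 ≤ ν := hν ▸ div_nonneg (Real.sqrt_nonneg _) hh.le
    have hνsq : ν ^ 2 - 1 / 4 = m / h ^ 2 := by
      rw [hν, div_pow, Real.sq_sqrt (by linarith [hm.1])]
      field_simp
      ring
    refine fun r hr ↦ hs0.flux_eq_zero_of_recessive (K := (K + E) / h ^ 2) hν0 hδ ?_ hC₀ hr
    filter_upwards [hVK] with r hr hr0
    have : Q r - (ν ^ 2 - 1 / 4) * (r ^ 2)⁻¹ = (V r - E) / h ^ 2 := by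
      rw [hνsq]
      simp only [hQ]
      ring
    rw [this, abs_div, abs_of_pos (by positivity : 0 < h ^ 2)]
    have h2 := abs_sub (V r) E
    rw [abs_of_pos hE0] at h2
    have h3 := hr hr0
    gcongr
    linarith
  set J := (conj (u₁ R) * u₁' R).im with hJdef
  have hJ : ∀ r, 0 < r → (conj (u₁ r) * u₁' r).im = J := fun r hr ↦ hs1.flux_eq hr hRpos
  have hcE : c ≤ E := (mul_le_of_le_one_right hEmin.le hθ1).trans hEm.1
  have hcm : ∀ r, ρ < r → c ≤ E - m * (r ^ 2)⁻¹ := by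
    intro r hr
    have hr0 : 0 < r := hρ0.trans_lt hr
    have hr2 : (S ^ 2 + 3 * R ^ 2) / 4 ≤ r ^ 2 :=
      (Real.sqrt_le_left hr0.le).1 ((le_max_right _ _).trans hr.le)
    have hMS : M0 V E ≤ E * S ^ 2 := by
      have h2 : R1 V E ^ 2 ≤ S ^ 2 := pow_le_pow_left₀ (Real.sqrt_nonneg _) (hRS E hEm) 2
      rwa [R1_sq hE0, div_le_iff₀ hE0, mul_comm] at h2
    have hM : Mplus V R E = (M0 V E + E * R ^ 2) / 2 := by
      rw [Mplus, R1_sq hE0]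
      field_simp
      ring
    have hm2 := hm.2
    rw [hM] at hm2
    have hc1 : E * (1 - θ) ≤ E - c := by
      have := mul_le_mul_of_nonneg_right hEm.1 hθ0.le
      rw [hc]
      linarith
    have hθ2 : (1 - θ) * ((S ^ 2 + 3 * R ^ 2) / 4) = (S ^ 2 + R ^ 2) / 2 := by
      rw [hθ]
      field_simp
      ring
    have h3 : m ≤ (E - c) * r ^ 2 := by
      calc m ≤ E * ((S ^ 2 + R ^ 2) / 2) := by linarith
        _ = E * (1 - θ) * ((S ^ 2 + 3 * R ^ 2) / 4) := by rw [mul_assoc, hθ2]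
        _ ≤ (E - c) * r ^ 2 := mul_le_mul hc1 hr2 (by positivity) (by linarith)
    have h4 : m * (r ^ 2)⁻¹ ≤ E - c := by
      rwa [← div_eq_mul_inv, div_le_iff₀ (by positivity)]
    linarith
  have hu1 : ∀ r, ρ < r → HasDerivAt u₁ (u₁' r) r := fun r hr ↦ hs1.hasDerivAt (hρ0.trans_lt hr)
  have hu1' : ∀ r, ρ < r →
      HasDerivAt u₁' ((((m * (r ^ 2)⁻¹ - E) / h ^ 2 : ℝ) : ℂ) * u₁ r) r := by
    intro r hr
    refine hs1.snd.hasDerivAt_of_ae_eq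
      (g := fun r ↦ (((m * (r ^ 2)⁻¹ - E) / h ^ 2 : ℝ) : ℂ) * u₁ r) hρ0 ?_ ?_ hr
    · refine ContinuousOn.mul (Complex.continuous_ofReal.comp_continuousOn ?_)
        (hs1.fst.continuousOn.mono (Ioi_subset_Ioi hρ0))
      refine ((continuousOn_const.mul ((continuousOn_id.pow 2).inv₀ fun x hx ↦ ?_)).sub
        continuousOn_const).div_const _
      exact pow_ne_zero 2 (hρ0.trans_lt hx).ne'
    · filter_upwards [hVa] with x hx hρx
      simp only [hQ]
      rw [hx ((le_max_left _ _).trans_lt hρx), zero_add]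
  obtain ⟨C₁, hC₁⟩ := hb1
  have hmain : ∀ r, ρ < r → c * ‖u₁ r‖ ^ 2 ≤ 2 * Real.sqrt E * (h * J) := fun r hr ↦
    norm_sq_le_flux_of_outgoing hρ0 hh hE0 hc0 hcE hcm hu1 hu1'
      (fun r hr ↦ hJ r (hρ0.trans_lt hr)) hC₁ hout hr
  have hJpos : 0 < J := by
    by_contra! hJle
    have hz : ∀ r, ρ < r → u₁ r = 0 := by
      intro r hr
      have h2 : c * ‖u₁ r‖ ^ 2 ≤ 0 := (hmain r hr).trans
        (mul_nonpos_of_nonneg_of_nonpos (by positivity)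
          (mul_nonpos_of_nonneg_of_nonpos hh.le hJle))
      have h3 : ‖u₁ r‖ ^ 2 ≤ 0 := nonpos_of_mul_nonpos_right h2 hc0
      simpa using le_antisymm h3 (sq_nonneg _)
    have hz' : ∀ r, ρ < r → u₁' r = 0 := by
      intro r hr
      refine (hu1 r hr).unique ((hasDerivAt_const r (0 : ℂ)).congr_of_eventuallyEq ?_)
      filter_upwards [Ioi_mem_nhds hr] with x hx using hz x hx
    obtain ⟨r, hr, hrne⟩ := hne1
    have hr : 0 < r := hr
    refine hrne (hs1.eq_zero_of_le (b := max r R) ?_ (hz _ (hρR.trans_le (le_max_right _ _)))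
      (hz' _ (hρR.trans_le (le_max_right _ _))) hr (le_max_left _ _))
    intro s hs
    refine ⟨(K + |m| * (s ^ 2)⁻¹ + E) / h ^ 2, ?_⟩
    filter_upwards [hVK] with x hx hsx
    have hx0 : 0 < x := hs.trans hsx
    simp only [hQ]
    rw [abs_div, abs_of_pos (by positivity : 0 < h ^ 2)]
    have h2 : |m * (x ^ 2)⁻¹| ≤ |m| * (s ^ 2)⁻¹ := by
      rw [abs_mul, abs_of_pos (by positivity : 0 < (x ^ 2)⁻¹)]
      gcongr
    have h3 := abs_sub (V x + m * (x ^ 2)⁻¹) E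
    have h4 := abs_add_le (V x) (m * (x ^ 2)⁻¹)
    have h5 := hx hx0
    rw [abs_of_pos hE0] at h3
    gcongr
    linarith
  have hkey : ∀ r, 0 < r → ‖u₀ r‖ * J ≤ ‖u₁ r‖ * ‖u₀ r * u₁' r - u₀' r * u₁ r‖ := by
    intro r hr
    rw [← hJ r hr]
    exact norm_mul_flux_le (hflux0 r hr)
  have hconst : ∀ r ∈ Ioi (0 : ℝ), ∀ r' ∈ Ioi (0 : ℝ),
      u₀ r * u₁' r - u₀' r * u₁ r = u₀ r' * u₁' r' - u₀' r' * u₁ r' :=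
    fun r hr r' hr' ↦ hs0.wronskian_eq hs1 hr hr'
  refine ⟨hconst, fun r hr hW ↦ ?_, fun r r' hr hrr' ↦ ?_⟩
  · obtain ⟨s, hs, hsne⟩ := hne0
    have h2 := hkey s hs
    rw [hconst s hs r hr, hW, norm_zero, mul_zero] at h2
    exact hsne (norm_le_zero_iff.1 (nonpos_of_mul_nonpos_left h2 hJpos))
  · have hr0 : 0 < r := hRpos.trans_le hr
    set W := ‖u₀ r * u₁' r - u₀' r * u₁ r‖ with hWdef
    have hW0 : 0 ≤ W := norm_nonneg _
    have hbd : ∀ s, ρ < s → ‖u₁ s‖ ^ 2 ≤ 2 * Real.sqrt Emax / c * (h * J) := by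
      intro s hs
      have h2 : c * ‖u₁ s‖ ^ 2 ≤ 2 * Real.sqrt Emax * (h * J) := (hmain s hs).trans (by
        have := hEm.2
        gcongr)
      rw [div_mul_eq_mul_div, le_div_iff₀ hc0]
      linarith
    have hprod : ‖u₁ r‖ * ‖u₁ r'‖ ≤ 2 * Real.sqrt Emax / c * (h * J) := by
      have e1 := hbd r (hρR.trans_le hr)
      have e2 := hbd r' (hρR.trans_le (hr.trans hrr'))
      linarith [two_mul_le_add_sq ‖u₁ r‖ ‖u₁ r'‖]
    rw [norm_mul]
    refine le_of_mul_le_mul_right ?_ hJpos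
    calc ‖u₀ r‖ * ‖u₁ r'‖ * J = ‖u₀ r‖ * J * ‖u₁ r'‖ := by ring
      _ ≤ ‖u₁ r‖ * W * ‖u₁ r'‖ := by
        have := hkey r hr0
        gcongr
      _ = ‖u₁ r‖ * ‖u₁ r'‖ * W := by ring
      _ ≤ 2 * Real.sqrt Emax / c * (h * J) * W := by gcongr
      _ = 2 * Real.sqrt Emax / c * h * W * J := by ring
end

section
/- Let V : (0,∞) → ℝ be measurable, essentially bounded, and compactly supported with R₀ > 0, let h > 0, E > 0, and let m ≥ M₀(V,E) (so that V(r) + m r⁻² − E ≥ 0 for almost every r ∈ (0, R₀]). Suppose u : (0, R₀] → ℝ has u, u' locally absolutely continuous, satisfies −h² u'' + (V + m r⁻² − E) u = 0 almost everywhere on (0, R₀], lim_{r→0⁺} u(r) = 0, and u > 0 on some interval (0, δ). Then u(r) ≥ 0 and u'(r) ≥ 0 for all r ∈ (0, R₀]. -/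
open MeasureTheory Set Filter

theorem M0_set_nonempty {V : ℝ → ℝ} (hR0 : 0 < R0 V) (E : ℝ)
    (hVbdd : ∃ Cv : ℝ, ∀ᵐ r ∂(volume.restrict (Ioi (0 : ℝ))), |V r| ≤ Cv) :
    {m : ℝ | 0 < m ∧ ∃ R' > R0 V,
      ∀ᵐ r ∂(volume.restrict (Ioi (0 : ℝ))), r < R' → 0 ≤ V r + m * (r ^ 2)⁻¹ - E}.Nonempty := by
  obtain ⟨C, hC⟩ := hVbdd
  have hR : 0 < R0 V + 1 := by linarith
  refine ⟨(|C| + |E| + 1) * (R0 V + 1) ^ 2, by positivity, R0 V + 1, by linarith, ?_⟩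
  filter_upwards [hC, ae_restrict_mem measurableSet_Ioi] with r hr hr0 hrR
  have hr0 : 0 < r := hr0
  have hsq : r ^ 2 ≤ (R0 V + 1) ^ 2 := by gcongr
  have hbig : |C| + |E| + 1 ≤ (|C| + |E| + 1) * (R0 V + 1) ^ 2 * (r ^ 2)⁻¹ := by
    rw [← div_eq_mul_inv, le_div_iff₀ (by positivity)]
    gcongr
  linarith [neg_abs_le (V r), le_abs_self C, le_abs_self E]

/-- The infimum defining `M0` is attained as far as the inequality on `(0,R₀]` is concerned. -/
theorem ae_nonneg_of_M0_le {V : ℝ → ℝ} (hR0 : 0 < R0 V) {E m : ℝ}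
    (hVbdd : ∃ Cv : ℝ, ∀ᵐ r ∂(volume.restrict (Ioi (0 : ℝ))), |V r| ≤ Cv) (hm : M0 V E ≤ m) :
    ∀ᵐ r ∂(volume.restrict (Ioc (0 : ℝ) (R0 V))), 0 ≤ V r + m * (r ^ 2)⁻¹ - E := by
  have happrox : ∀ n : ℕ, ∀ᵐ r ∂(volume.restrict (Ioc (0 : ℝ) (R0 V))),
      0 ≤ V r + (m + 1 / ((n : ℝ) + 1)) * (r ^ 2)⁻¹ - E := by
    intro n
    have hn : (0 : ℝ) < 1 / ((n : ℝ) + 1) := Nat.one_div_pos_of_nat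
    obtain ⟨m', ⟨-, R', hR', hae⟩, hlt⟩ := exists_lt_of_csInf_lt (M0_set_nonempty hR0 E hVbdd)
      (show M0 V E < m + 1 / ((n : ℝ) + 1) by linarith)
    filter_upwards [ae_restrict_of_ae_restrict_of_subset Ioc_subset_Ioi_self hae,
      ae_restrict_mem measurableSet_Ioc] with r hr hrmem
    have hmul : m' * (r ^ 2)⁻¹ ≤ (m + 1 / ((n : ℝ) + 1)) * (r ^ 2)⁻¹ := by gcongr
    linarith [hr (hrmem.2.trans_lt hR')]
  filter_upwards [ae_all_iff.2 happrox] with r hr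
  have hlim : Tendsto (fun n : ℕ => V r + (m + 1 / ((n : ℝ) + 1)) * (r ^ 2)⁻¹ - E) atTop
      (nhds (V r + (m + 0) * (r ^ 2)⁻¹ - E)) :=
    (((tendsto_one_div_add_atTop_nhds_zero_nat.const_add m).mul_const _).const_add _).sub_const _
  simpa using ge_of_tendsto' hlim hr

theorem continuousOn_of_sub_eq_integral {f f' : ℝ → ℝ} {a b : ℝ}
    (hint : IntervalIntegrable f' volume a b)
    (hf : ∀ x ∈ Icc a b, f x - f a = ∫ t in a..x, f' t) : ContinuousOn f (Icc a b) := by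
  rcases lt_or_ge b a with hab | hab
  · simp [Icc_eq_empty_of_lt hab]
  have hcont : ContinuousOn (fun x => ∫ t in a..x, f' t) (Icc a b) := by
    simpa [uIcc_of_le hab] using
      intervalIntegral.continuousOn_primitive_interval' hint left_mem_uIcc
  refine (hcont.const_add (f a)).congr fun x hx => ?_
  simp only [← hf x hx]
  ring

/-- A function vanishing at `0⁺` whose second derivative is nonnegative wherever it is positive
has nonnegative derivative as long as it stays positive. -/
theorem deriv_nonneg_of_pos_of_tendsto_zero {u u' u'' : ℝ → ℝ} {R c : ℝ}
    (hu : ∀ a b : ℝ, 0 < a → a ≤ b → b ≤ R →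
      IntervalIntegrable u' volume a b ∧ u b - u a = ∫ x in a..b, u' x)
    (hu' : ∀ a b : ℝ, 0 < a → a ≤ b → b ≤ R →
      IntervalIntegrable u'' volume a b ∧ u' b - u' a = ∫ x in a..b, u'' x)
    (hsign : ∀ᵐ r ∂(volume.restrict (Ioc (0 : ℝ) R)), 0 < u r → 0 ≤ u'' r)
    (hlim : Tendsto u (nhdsWithin 0 (Ioi (0 : ℝ))) (nhds 0)) (hcR : c ≤ R)
    (hpos : ∀ r ∈ Ioo 0 c, 0 < u r) : ∀ r ∈ Ioc 0 c, 0 ≤ u' r := by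
  have hmono : ∀ a b : ℝ, 0 < a → a ≤ b → b ≤ c → u' a ≤ u' b := by
    intro a b ha hab hbc
    have hae : 0 ≤ᵐ[volume.restrict (Ioc a b)] u'' := by
      have hsub : Ioc a b ⊆ Ioc 0 R := Ioc_subset_Ioc ha.le (hbc.trans hcR)
      have hne : ∀ᵐ r ∂(volume.restrict (Ioc a b)), r ≠ b :=
        ae_restrict_of_ae (Measure.ae_ne volume b)
      filter_upwards [ae_restrict_of_ae_restrict_of_subset hsub hsign, hne,
        ae_restrict_mem measurableSet_Ioc] with r hr hrb hrmem
      exact hr (hpos r ⟨ha.trans hrmem.1, (lt_of_le_of_ne hrmem.2 hrb).trans_le hbc⟩)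
    have hint : 0 ≤ ∫ x in a..b, u'' x := by
      rw [intervalIntegral.integral_of_le hab]
      exact integral_nonneg_of_ae hae
    linarith [(hu' a b ha hab (hbc.trans hcR)).2]
  rintro s ⟨hs0, hsc⟩
  by_contra! hneg
  have hbelow : ∀ r ∈ Ioo 0 (s / 2), u (s / 2) ≤ u r := by
    rintro r ⟨hr0, hrs⟩
    have hint : ∫ x in r..s / 2, u' x ≤ 0 := by
      rw [← neg_nonneg, ← intervalIntegral.integral_neg]
      refine intervalIntegral.integral_nonneg hrs.le fun x hx => ?_
      linarith [hmono x s (hr0.trans_le hx.1) (by linarith [hx.2]) hsc]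
    linarith [(hu r (s / 2) hr0 hrs.le (by linarith)).2]
  have hle : u (s / 2) ≤ 0 :=
    ge_of_tendsto hlim (mem_of_superset (Ioo_mem_nhdsGT (half_pos hs0)) hbelow)
  linarith [hpos (s / 2) ⟨half_pos hs0, by linarith⟩]

/-- A function vanishing at `0⁺`, initially positive, whose second derivative is nonnegative
wherever it is positive, stays positive. -/
theorem pos_of_eventually_pos_of_tendsto_zero {u u' u'' : ℝ → ℝ} {R : ℝ}
    (hu : ∀ a b : ℝ, 0 < a → a ≤ b → b ≤ R →
      IntervalIntegrable u' volume a b ∧ u b - u a = ∫ x in a..b, u' x)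
    (hu' : ∀ a b : ℝ, 0 < a → a ≤ b → b ≤ R →
      IntervalIntegrable u'' volume a b ∧ u' b - u' a = ∫ x in a..b, u'' x)
    (hsign : ∀ᵐ r ∂(volume.restrict (Ioc (0 : ℝ) R)), 0 < u r → 0 ≤ u'' r)
    (hlim : Tendsto u (nhdsWithin 0 (Ioi (0 : ℝ))) (nhds 0))
    (hpos : ∃ δ > (0 : ℝ), ∀ r ∈ Ioo (0 : ℝ) δ, 0 < u r) : ∀ r ∈ Ioc 0 R, 0 < u r := by
  obtain ⟨δ, hδ, hpos⟩ := hpos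
  rintro r ⟨hr0, hrR⟩
  by_contra! hur
  have hδr : δ ≤ r := by
    by_contra! hlt
    exact hur.not_gt (hpos r ⟨hr0, hlt⟩)
  have hcont : ContinuousOn u (Icc (δ / 2) R) :=
    continuousOn_of_sub_eq_integral (hu _ _ (half_pos hδ) (by linarith) le_rfl).1
      fun x hx => (hu _ _ (half_pos hδ) hx.1 hx.2).2
  have hcomp : IsCompact (Icc (δ / 2) R ∩ u ⁻¹' Iic 0) :=
    isCompact_Icc.of_isClosed_subset
      (hcont.preimage_isClosed_of_isClosed isClosed_Icc isClosed_Iic) inter_subset_left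
  obtain ⟨z, ⟨⟨hδz, hzR⟩, huz⟩, hzmin⟩ :=
    hcomp.exists_isLeast ⟨r, ⟨by linarith, hrR⟩, hur⟩
  have huz : u z ≤ 0 := huz
  have hz0 : 0 < z := (half_pos hδ).trans_le hδz
  have hposz : ∀ x ∈ Ioo 0 z, 0 < u x := by
    rintro x ⟨hx0, hxz⟩
    by_contra! hux
    have hxδ : δ ≤ x := by
      by_contra! hlt
      exact hux.not_gt (hpos x ⟨hx0, hlt⟩)
    exact hxz.not_ge (hzmin ⟨⟨by linarith, hxz.le.trans hzR⟩, hux⟩)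
  have hderiv := deriv_nonneg_of_pos_of_tendsto_zero hu hu' hsign hlim hzR hposz
  have hint : 0 ≤ ∫ x in z / 2..z, u' x :=
    intervalIntegral.integral_nonneg (by linarith) fun x hx =>
      hderiv x ⟨by linarith [hx.1], hx.2⟩
  linarith [(hu (z / 2) z (half_pos hz0) (by linarith) hzR).2,
    hposz (z / 2) ⟨half_pos hz0, by linarith⟩]

/-- Monotonicity of the recessive solution: if `m ≥ M₀(V,E)` and `u` is a
real solution of `-h²u'' + (V + m r⁻² - E)u = 0` on `(0,R₀]` with `u → 0`
at `0⁺` and `u > 0` near `0`, then `u ≥ 0` and `u' ≥ 0` on `(0,R₀]`. -/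
theorem recessive_solution_monotone
    (V : ℝ → ℝ) (hVmeas : Measurable V)
    (hVbdd : ∃ Cv : ℝ, ∀ᵐ r ∂(volume.restrict (Ioi (0 : ℝ))), |V r| ≤ Cv)
    (hVsupp : HasCompactSupport V) (hR0 : 0 < R0 V)
    (h E m : ℝ) (hh : 0 < h) (hE : 0 < E) (hm : M0 V E ≤ m)
    (u u' u'' : ℝ → ℝ)
    (hu : ∀ a b : ℝ, 0 < a → a ≤ b → b ≤ R0 V →
      IntervalIntegrable u' volume a b ∧ u b - u a = ∫ x in a..b, u' x)
    (hu' : ∀ a b : ℝ, 0 < a → a ≤ b → b ≤ R0 V →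
      IntervalIntegrable u'' volume a b ∧ u' b - u' a = ∫ x in a..b, u'' x)
    (heq : ∀ᵐ r ∂(volume.restrict (Ioc (0 : ℝ) (R0 V))),
      -h ^ 2 * u'' r + (V r + m * (r ^ 2)⁻¹ - E) * u r = 0)
    (hlim : Tendsto u (nhdsWithin 0 (Ioi (0 : ℝ))) (nhds 0))
    (hpos : ∃ δ > (0 : ℝ), ∀ r ∈ Ioo (0 : ℝ) δ, 0 < u r) :
    ∀ r ∈ Ioc (0 : ℝ) (R0 V), 0 ≤ u r ∧ 0 ≤ u' r := by
  have hsign : ∀ᵐ r ∂(volume.restrict (Ioc (0 : ℝ) (R0 V))), 0 < u r → 0 ≤ u'' r := by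
    filter_upwards [heq, ae_nonneg_of_M0_le hR0 hVbdd hm] with r hr hW hur
    have hprod : 0 ≤ h ^ 2 * u'' r := by linarith [mul_nonneg hW hur.le]
    exact nonneg_of_mul_nonneg_right hprod (by positivity)
  have hpos' := pos_of_eventually_pos_of_tendsto_zero hu hu' hsign hlim hpos
  exact fun r hr => ⟨(hpos' r hr).le, deriv_nonneg_of_pos_of_tendsto_zero hu hu' hsign hlim le_rfl
    (fun x hx => hpos' x ⟨hx.1, hx.2.le⟩) r hr⟩
end

section
/- Let a < b be real numbers and let f : [a,b] → ℝ be continuous with f and f' locally absolutely continuous on (a,b), f' continuous on (a,b], f(a) = 0, and f''(t) f(t) ≥ 0 for Lebesgue-almost every t ∈ (a,b). Then f has a fixed sign on [a,b] (either f ≥ 0 everywhere on [a,b] or f ≤ 0 everywhere on [a,b]), and f(b) and f'(b) have the same sign: if f ≥ 0 on [a,b] then f'(b) ≥ 0, and if f ≤ 0 on [a,b] then f'(b) ≤ 0. -/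
open MeasureTheory Set

/-- If `f` vanishes at `a`, is positive somewhere on `[a,b]` and satisfies `f'' f ≥ 0` almost
everywhere, then both `f` and `f'` are positive at `b`. -/
theorem pos_right_endpoint_of_pos
    {a b : ℝ} {f f' f'' : ℝ → ℝ}
    (hf_cont : ContinuousOn f (Icc a b))
    (hf_AC : ∀ c d : ℝ, a < c → c ≤ d → d ≤ b →
      IntervalIntegrable f' volume c d ∧ f d - f c = ∫ x in c..d, f' x)
    (hf'_AC : ∀ c d : ℝ, a < c → c ≤ d → d ≤ b →
      IntervalIntegrable f'' volume c d ∧ f' d - f' c = ∫ x in c..d, f'' x)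
    (hfa : f a = 0)
    (hsign : ∀ᵐ t ∂(volume.restrict (Ioo a b)), 0 ≤ f'' t * f t)
    {t : ℝ} (ht : t ∈ Icc a b) (hft : 0 < f t) : 0 < f b ∧ 0 < f' b := by
  have hat : a < t := lt_of_le_of_ne ht.1 (by rintro rfl; linarith)
  have f'_le : ∀ s u, a < s → s ≤ u → u ≤ b → (∀ x ∈ Ioo s u, 0 < f x) → f' s ≤ f' u := by
    intro s u has hsu hub hpos
    have h := (hf'_AC s u has hsu hub).2
    have hnn : 0 ≤ ∫ x in s..u, f'' x := by
      rw [intervalIntegral.integral_of_le hsu, integral_Ioc_eq_integral_Ioo]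
      apply integral_nonneg_of_ae
      filter_upwards [ae_restrict_of_ae_restrict_of_subset (Ioo_subset_Ioo has.le hub) hsign,
        ae_restrict_mem measurableSet_Ioo] with x hx hxm
      exact nonneg_of_mul_nonneg_left hx (hpos x hxm)
    linarith
  obtain ⟨s, has, hsb, hfs, hf's⟩ : ∃ s, a < s ∧ s ≤ b ∧ 0 < f s ∧ 0 < f' s := by
    obtain ⟨c₀, hc₀, hfc₀⟩ : f t / 2 ∈ f '' Ioo a t :=
      intermediate_value_Ioo hat.le (hf_cont.mono (Icc_subset_Icc_right ht.2))
        ⟨by linarith, by linarith⟩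
    have hcomp : IsCompact (Icc c₀ t ∩ f ⁻¹' Iic (f t / 2)) :=
      isCompact_Icc.of_isClosed_subset
        ((hf_cont.mono (Icc_subset_Icc hc₀.1.le ht.2)).preimage_isClosed_of_isClosed
          isClosed_Icc isClosed_Iic) inter_subset_left
    obtain ⟨c, ⟨hc, hfc⟩, hcmax⟩ :=
      hcomp.exists_isGreatest ⟨c₀, left_mem_Icc.2 hc₀.2.le, hfc₀.le⟩
    have hac : a < c := hc₀.1.trans_le hc.1
    have hfc : f c ≤ f t / 2 := hfc
    by_contra! hcon
    have h := (hf_AC c t hac hc.2 ht.2).2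
    have hnp : ∫ x in c..t, f' x ≤ 0 := by
      rw [intervalIntegral.integral_of_le hc.2]
      refine setIntegral_nonpos measurableSet_Ioc fun x hx => ?_
      refine hcon x (hac.trans hx.1) (hx.2.trans ht.2) ?_
      by_contra! hfx
      exact hx.1.not_ge (hcmax ⟨⟨hc.1.trans hx.1.le, hx.2⟩,
        show f x ≤ f t / 2 by linarith⟩)
    linarith
  have le_of_pos : ∀ u, s ≤ u → u ≤ b → (∀ x ∈ Ioo s u, 0 < f x) → f s ≤ f u := by
    intro u hsu hub hpos
    have h := (hf_AC s u has hsu hub).2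
    have hnn : 0 ≤ ∫ x in s..u, f' x := by
      rw [intervalIntegral.integral_of_le hsu]
      refine setIntegral_nonneg measurableSet_Ioc fun x hx => hf's.le.trans ?_
      exact f'_le s x has hx.1.le (hx.2.trans hub)
        fun y hy => hpos y ⟨hy.1, hy.2.trans_le hx.2⟩
    linarith
  have hpos : ∀ x ∈ Icc s b, 0 < f x := by
    by_contra! ⟨x, hx, hfx⟩
    have hcomp : IsCompact (Icc s b ∩ f ⁻¹' Iic 0) :=
      isCompact_Icc.of_isClosed_subset
        ((hf_cont.mono (Icc_subset_Icc_left has.le)).preimage_isClosed_of_isClosed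
          isClosed_Icc isClosed_Iic) inter_subset_left
    obtain ⟨u, ⟨hu, hfu⟩, humin⟩ := hcomp.exists_isLeast ⟨x, hx, hfx⟩
    have hfu : f u ≤ 0 := hfu
    have := le_of_pos u hu.1 hu.2 fun y hy => by
      by_contra! hfy
      exact hy.2.not_ge (humin ⟨⟨hy.1.le, hy.2.le.trans hu.2⟩, hfy⟩)
    linarith
  exact ⟨hpos b (right_mem_Icc.2 hsb),
    hf's.trans_le (f'_le s b has hsb le_rfl fun x hx => hpos x (Ioo_subset_Icc_self hx))⟩

/-- Sign lemma for functions with `f''f ≥ 0`: if `f` is continuous on `[a,b]`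
with `f(a) = 0`, `f` and `f'` are (locally) absolutely continuous on `(a,b]`
with `f'` continuous on `(a,b]`, and `f''(t)f(t) ≥ 0` almost everywhere, then
`f` has a fixed sign on `[a,b]` and `f'(b)` has the same sign as `f(b)`. -/
theorem sign_lemma
    (a b : ℝ) (hab : a < b) (f f' f'' : ℝ → ℝ)
    (hf_cont : ContinuousOn f (Icc a b))
    (hf'_cont : ContinuousOn f' (Ioc a b))
    (hf_AC : ∀ c d : ℝ, a < c → c ≤ d → d ≤ b →
      IntervalIntegrable f' volume c d ∧ f d - f c = ∫ x in c..d, f' x)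
    (hf'_AC : ∀ c d : ℝ, a < c → c ≤ d → d ≤ b →
      IntervalIntegrable f'' volume c d ∧ f' d - f' c = ∫ x in c..d, f'' x)
    (hfa : f a = 0)
    (hsign : ∀ᵐ t ∂(volume.restrict (Ioo a b)), 0 ≤ f'' t * f t) :
    ((∀ t ∈ Icc a b, 0 ≤ f t) ∧ 0 ≤ f' b) ∨
      ((∀ t ∈ Icc a b, f t ≤ 0) ∧ f' b ≤ 0) := by
  have hpos : ∀ t ∈ Icc a b, 0 < f t → 0 < f b ∧ 0 < f' b := fun t ht hft =>
    pos_right_endpoint_of_pos hf_cont hf_AC hf'_AC hfa hsign ht hft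
  have hneg : ∀ t ∈ Icc a b, f t < 0 → f b < 0 ∧ f' b < 0 := by
    intro t ht hft
    have h := pos_right_endpoint_of_pos (f := fun x => -f x) (f' := fun x => -f' x)
      (f'' := fun x => -f'' x) hf_cont.neg
      (fun c d hc hcd hd => ⟨(hf_AC c d hc hcd hd).1.neg, by
        rw [intervalIntegral.integral_neg, ← (hf_AC c d hc hcd hd).2]; ring⟩)
      (fun c d hc hcd hd => ⟨(hf'_AC c d hc hcd hd).1.neg, by
        rw [intervalIntegral.integral_neg, ← (hf'_AC c d hc hcd hd).2]; ring⟩)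
      (by simp [hfa]) (by simpa using hsign) ht (by simpa using hft)
    simpa using h
  have hb : b ∈ Icc a b := right_mem_Icc.2 hab.le
  have nonneg_of : 0 ≤ f b → ∀ t ∈ Icc a b, 0 ≤ f t := fun h t ht =>
    not_lt.1 fun hft => h.not_gt (hneg t ht hft).1
  have nonpos_of : f b ≤ 0 → ∀ t ∈ Icc a b, f t ≤ 0 := fun h t ht =>
    not_lt.1 fun hft => h.not_gt (hpos t ht hft).1
  rcases lt_trichotomy (f b) 0 with h | h | h
  · exact Or.inr ⟨nonpos_of h.le, (hneg b hb h).2.le⟩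
  · rcases le_total 0 (f' b) with h' | h'
    · exact Or.inl ⟨nonneg_of h.ge, h'⟩
    · exact Or.inr ⟨nonpos_of h.le, h'⟩
  · exact Or.inl ⟨nonneg_of h.le, (hpos b hb h).2.le⟩
end
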